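/- arXiv:nlin/0108049 — 4 statements merged into one kernel-verified Lean document; each statement's English description precedes it below -/
import Mathlib

section
/- Assume γ(n) ≠ 0 for all n ∈ ℤ, and assume there exist nonzero complex constants u and v such that α_{d2}(n) = v·∏_{j=1}^{d2} γ(n−j) and β_{d1}(n) = u·∏_{j=1}^{d1} γ(n−j) for all n ∈ ℤ (so in particular α_{d2}(n) ≠ 0 and β_{d1}(n) ≠ 0 for all n). Then for every N ∈ ℤ and all x, y ∈ ℂ the following identity of characteristic polynomials holds: u·det(x·1_{d1+1} − D2_N(y)) = v·det(y·1_{d2+1} − D̲1_N(x)). -/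
open Matrix BigOperators

noncomputable def aMat (d2 : ℕ) (α : ℤ → ℤ → ℂ) (γ : ℤ → ℂ) (N : ℤ) (x : ℂ) :
    Matrix (Fin (d2 + 1)) (Fin (d2 + 1)) ℂ :=
  Matrix.of fun i b =>
    if (i : ℕ) < d2 then (if (b : ℕ) = (i : ℕ) + 1 then 1 else 0)
    else if (b : ℕ) = d2 then (x - α 0 N) / γ N
    else -α ((d2 : ℤ) - ((b : ℕ) : ℤ)) N / γ N

noncomputable def aProd (d2 : ℕ) (α : ℤ → ℤ → ℂ) (γ : ℤ → ℂ) (N : ℤ) (x : ℂ) :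
    ℕ → Matrix (Fin (d2 + 1)) (Fin (d2 + 1)) ℂ
  | 0 => 1
  | j + 1 => aMat d2 α γ (N + (j : ℤ)) x * aProd d2 α γ N x j

noncomputable def abarMat (d2 : ℕ) (α : ℤ → ℤ → ℂ) (γ : ℤ → ℂ) (N : ℤ) (x : ℂ) :
    Matrix (Fin (d2 + 1)) (Fin (d2 + 1)) ℂ :=
  Matrix.of fun i b =>
    if (b : ℕ) = 0 then
      (if (i : ℕ) = 0 then (x - α 0 N) / γ (N - 1)
       else -α ((i : ℕ) : ℤ) (N + ((i : ℕ) : ℤ)) / γ (N - 1))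
    else if (b : ℕ) = (i : ℕ) + 1 then 1 else 0

noncomputable def abarProd (d2 : ℕ) (α : ℤ → ℤ → ℂ) (γ : ℤ → ℂ) (N : ℤ) (x : ℂ) :
    ℕ → Matrix (Fin (d2 + 1)) (Fin (d2 + 1)) ℂ
  | 0 => 1
  | j + 1 => abarProd d2 α γ N x j * abarMat d2 α γ (N - 1 - (j : ℤ)) x

noncomputable def D2Mat (d1 d2 : ℕ) (α β : ℤ → ℤ → ℂ) (γ : ℤ → ℂ) (N : ℤ) (y : ℂ) :
    Matrix (Fin (d1 + 1)) (Fin (d1 + 1)) ℂ :=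
  Matrix.diagonal (fun i : Fin _ => γ (N - (d1 : ℤ) - 1 + ((i : ℕ) : ℤ))) * (aMat d1 β γ (N - 1) y)⁻¹
    + Matrix.diagonal (fun i : Fin _ => α 0 (N - (d1 : ℤ) + ((i : ℕ) : ℤ)))
    + ∑ j ∈ Finset.Icc 1 d2,
        Matrix.diagonal (fun i : Fin _ => α (j : ℤ) (N + (j : ℤ) - (d1 : ℤ) + ((i : ℕ) : ℤ)))
          * aProd d1 β γ N y j

noncomputable def D1barMat (d1 d2 : ℕ) (α β : ℤ → ℤ → ℂ) (γ : ℤ → ℂ) (N : ℤ) (x : ℂ) :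
    Matrix (Fin (d2 + 1)) (Fin (d2 + 1)) ℂ :=
  (abarMat d2 α γ N x)⁻¹ * Matrix.diagonal (fun i : Fin _ => γ (N - 1 + ((i : ℕ) : ℤ)))
    + Matrix.diagonal (fun i : Fin _ => β 0 (N - 1 + ((i : ℕ) : ℤ)))
    + ∑ j ∈ Finset.Icc 1 d1,
        abarProd d2 α γ N x j * Matrix.diagonal (fun i : Fin _ => β (j : ℤ) (N - 1 + ((i : ℕ) : ℤ)))


/-- Position of a column of `sylvesterMat` among the sites `N - d1 - 1, …, N + d2`. -/
def site {d1 d2 : ℕ} : Fin (d1 + 1) ⊕ Fin (d2 + 1) → ℕ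
  | Sum.inl i => i
  | Sum.inr k => d1 + 1 + k

/-- The matrix of the combined linear system `(y - B) φ = 0`, `(x - Aᵀ) φ = ψ` on the sites
`N - d1 - 1, …, N + d2`, which are the columns. -/
noncomputable def sylvesterMat (d1 d2 : ℕ) (α β : ℤ → ℤ → ℂ) (N : ℤ) (x y : ℂ) :
    Matrix (Fin (d1 + 1) ⊕ Fin (d2 + 1)) (Fin (d1 + 1) ⊕ Fin (d2 + 1)) ℂ :=
  Matrix.of fun r s => Sum.elim
    (fun i : Fin (d1 + 1) => (if site s = (i : ℕ) + 1 then x else 0)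
      - α ((site s : ℤ) - ((i : ℕ) : ℤ) - 1) (N - 1 - (d1 : ℤ) + (site s : ℤ)))
    (fun j : Fin (d2 + 1) => (if site s = (j : ℕ) + d1 then y else 0)
      - β ((d1 : ℤ) + ((j : ℕ) : ℤ) - (site s : ℤ)) (N - 1 + ((j : ℕ) : ℤ))) r

lemma aMat_mul_apply_of_lt {d : ℕ} (β : ℤ → ℤ → ℂ) (γ : ℤ → ℂ) (n : ℤ) (y : ℂ)
    (P : Matrix (Fin (d + 1)) (Fin (d + 1)) ℂ) (r : ℕ) (hr : r + 1 < d + 1) (i : Fin (d + 1)) :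
    (aMat d β γ n y * P) ⟨r, by omega⟩ i = P ⟨r + 1, hr⟩ i := by
  rw [Matrix.mul_apply, Finset.sum_eq_single ⟨r + 1, hr⟩]
  · simp [aMat, show r < d by omega]
  · intro b _ hb
    have hb' : (b : ℕ) ≠ r + 1 := fun h => hb (Fin.ext h)
    simp [aMat, show r < d by omega, hb']
  · simp

lemma aMat_mul_apply_last {d : ℕ} (β : ℤ → ℤ → ℂ) (γ : ℤ → ℂ) (n : ℤ) (y : ℂ) (hγ : γ n ≠ 0)
    (P : Matrix (Fin (d + 1)) (Fin (d + 1)) ℂ) (i : Fin (d + 1)) :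
    γ n * (aMat d β γ n y * P) (Fin.last d) i =
      y * P (Fin.last d) i - ∑ b : Fin (d + 1), β ((d : ℤ) - ((b : ℕ) : ℤ)) n * P b i := by
  rw [Matrix.mul_apply, Fin.sum_univ_castSucc, Fin.sum_univ_castSucc, mul_add, Finset.mul_sum]
  have h : ∀ b : Fin d, γ n * (aMat d β γ n y (Fin.last d) b.castSucc * P b.castSucc i) =
      -(β ((d : ℤ) - ((b : ℕ) : ℤ)) n * P b.castSucc i) := by
    intro b
    have hb := b.2.ne
    simp [aMat, hb]
    field_simp
  simp only [h, Finset.sum_neg_distrib, Fin.val_castSucc]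
  simp [aMat]
  field_simp
  ring

lemma isUnit_det_aMat {d : ℕ} (β : ℤ → ℤ → ℂ) (γ : ℤ → ℂ) (n : ℤ) (y : ℂ) (hd : 1 ≤ d)
    (hγ : γ n ≠ 0) (hβ : β d n ≠ 0) : IsUnit (aMat d β γ n y).det := by
  rw [isUnit_iff_ne_zero]
  intro h0
  obtain ⟨w, hw, h⟩ := Matrix.exists_mulVec_eq_zero_iff.mpr h0
  apply hw
  set P : Matrix (Fin (d + 1)) (Fin (d + 1)) ℂ := Matrix.of fun b _ => w b with hP
  have hz : aMat d β γ n y * P = 0 := by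
    ext r i
    simpa [Matrix.mul_apply, Matrix.mulVec, dotProduct, hP] using congrFun h r
  have hs : ∀ r (hr : r + 1 < d + 1), w ⟨r + 1, hr⟩ = 0 := by
    intro r hr
    have := aMat_mul_apply_of_lt β γ n y P r hr 0
    rw [hz] at this
    simpa [hP] using this.symm
  have hsucc : ∀ b : Fin d, w b.succ = 0 := fun b => hs b (by omega)
  have hl := aMat_mul_apply_last β γ n y hγ P 0
  rw [hz, Fin.sum_univ_succ] at hl
  have hlast : w (Fin.last d) = 0 := by
    obtain ⟨e, rfl⟩ : ∃ e, d = e + 1 := ⟨d - 1, by omega⟩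
    exact hsucc (Fin.last e)
  simp [hP, hsucc, hlast, hβ] at hl
  funext b
  refine Fin.cases ?_ (fun c => ?_) b
  · simpa using hl
  · simpa using hsucc c

/-- Row windows of the fundamental solution of `(y - B) φ = 0`, starting at site `N - 1`. -/
noncomputable def window (d : ℕ) (β : ℤ → ℤ → ℂ) (γ : ℤ → ℂ) (N : ℤ) (y : ℂ) :
    ℕ → Matrix (Fin (d + 1)) (Fin (d + 1)) ℂ
  | 0 => (aMat d β γ (N - 1) y)⁻¹
  | j + 1 => aProd d β γ N y j

lemma window_succ {d : ℕ} {β : ℤ → ℤ → ℂ} {γ : ℤ → ℂ} {N : ℤ} {y : ℂ}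
    (hu : IsUnit (aMat d β γ (N - 1) y).det) (j : ℕ) :
    window d β γ N y (j + 1) = aMat d β γ (N - 1 + j) y * window d β γ N y j := by
  cases j with
  | zero => simp [window, aProd, Matrix.mul_nonsing_inv _ hu]
  | succ j =>
    simp only [window, aProd]
    congr 2
    push_cast
    ring

lemma window_apply {d : ℕ} {β : ℤ → ℤ → ℂ} {γ : ℤ → ℂ} {N : ℤ} {y : ℂ}
    (hu : IsUnit (aMat d β γ (N - 1) y).det) (r : ℕ) (hr : r < d + 1) (j : ℕ)
    (i : Fin (d + 1)) :
    window d β γ N y j ⟨r, hr⟩ i = window d β γ N y (j + r) 0 i := by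
  induction r generalizing j with
  | zero => rfl
  | succ r ih =>
    rw [← aMat_mul_apply_of_lt β γ (N - 1 + j) y (window d β γ N y j) r hr i, ← window_succ hu,
      ih (by omega), show j + 1 + r = j + (r + 1) by omega]

lemma window_recurrence {d : ℕ} {β : ℤ → ℤ → ℂ} {γ : ℤ → ℂ} {N : ℤ} {y : ℂ}
    (hu : IsUnit (aMat d β γ (N - 1) y).det) (hβγ : ∀ n, β (-1) n = γ n) (hγ : ∀ n, γ n ≠ 0)
    (j : ℕ) (i : Fin (d + 1)) :
    ∑ k ∈ Finset.range (d + 2), β ((d : ℤ) - (k : ℤ)) (N - 1 + j) * window d β γ N y (j + k) 0 i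
      = y * window d β γ N y (j + d) 0 i := by
  have h := aMat_mul_apply_last β γ (N - 1 + j) y (hγ _) (window d β γ N y j) i
  rw [← window_succ hu] at h
  have hl : ∀ m, window d β γ N y m (Fin.last d) i = window d β γ N y (m + d) 0 i :=
    fun m => window_apply hu d (by omega) m i
  have hs : ∀ b : Fin (d + 1), window d β γ N y j b i = window d β γ N y (j + b) 0 i :=
    fun b => window_apply hu b b.2 j i
  rw [hl, hl] at h
  simp only [hs] at h
  rw [Finset.sum_range_succ, Finset.sum_range, show (d : ℤ) - ((d + 1 : ℕ) : ℤ) = -1 by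
    push_cast; ring, hβγ, show j + (d + 1) = j + 1 + d by omega, h]
  ring

lemma D2Mat_apply {d1 d2 : ℕ} {α β : ℤ → ℤ → ℂ} {γ : ℤ → ℂ} {N : ℤ} {y : ℂ}
    (hu : IsUnit (aMat d1 β γ (N - 1) y).det) (hαγ : ∀ n, α (-1) n = γ n)
    (r i : Fin (d1 + 1)) :
    D2Mat d1 d2 α β γ N y r i = ∑ k ∈ Finset.range (d2 + 2),
      α ((k : ℤ) - 1) (N - 1 - d1 + (k + (r : ℕ) : ℕ)) * window d1 β γ N y (k + r) 0 i := by
  have hs : ∀ k, window d1 β γ N y (k + r) 0 i = window d1 β γ N y k r i :=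
    fun k => (window_apply hu r r.2 k i).symm
  simp only [hs]
  rw [Finset.sum_range_succ', Finset.sum_range_succ']
  simp only [D2Mat, Matrix.add_apply, Matrix.sum_apply, Matrix.diagonal_mul]
  rw [← Finset.Ico_add_one_right_eq_Icc, Finset.sum_Ico_eq_sum_range, Nat.add_sub_cancel,
    Matrix.diagonal_apply]
  have h0 : window d1 β γ N y (0 + 1) r i = if r = i then 1 else 0 := by
    simp [window, aProd, Matrix.one_apply]
  have hsum : ∀ k ∈ Finset.range d2,
      α ((1 + k : ℕ) : ℤ) (N + ((1 + k : ℕ) : ℤ) - d1 + ((r : ℕ) : ℤ))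
        * aProd d1 β γ N y (1 + k) r i
      = α (((k + 1 + 1 : ℕ) : ℤ) - 1) (N - 1 - d1 + ((k + 1 + 1 + (r : ℕ) : ℕ) : ℤ))
        * window d1 β γ N y (k + 1 + 1) r i := by
    intro k _
    rw [show window d1 β γ N y (k + 1 + 1) = aProd d1 β γ N y (1 + k) by
      rw [add_comm 1 k]; rfl]
    congr 2 <;> push_cast <;> ring
  rw [Finset.sum_congr rfl hsum, h0]
  simp only [Nat.cast_zero, zero_sub, hαγ, zero_add, Nat.cast_one, sub_self, mul_ite, mul_one,
    mul_zero, Nat.cast_add]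
  rw [show N - d1 - 1 + ((r : ℕ) : ℤ) = N - 1 - d1 + ((r : ℕ) : ℤ) by ring,
    show N - d1 + ((r : ℕ) : ℤ) = N - 1 - d1 + (1 + ((r : ℕ) : ℤ)) by ring]
  simp only [window]
  ring

lemma sum_site {d1 d2 : ℕ} (f : ℕ → ℂ) (a m : ℕ) (ham : a + m ≤ d1 + d2 + 2)
    (hf : ∀ c, c < a ∨ a + m ≤ c → f c = 0) :
    ∑ s : Fin (d1 + 1) ⊕ Fin (d2 + 1), f (site s) = ∑ k ∈ Finset.range m, f (k + a) := by
  simp only [Fintype.sum_sum_type, site]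
  rw [← Finset.sum_range (fun i => f i), ← Finset.sum_range (fun k => f (d1 + 1 + k)),
    ← Finset.sum_range_add]
  have hshift : ∑ k ∈ Finset.range m, f (k + a) = ∑ c ∈ Finset.Ico a (a + m), f c := by
    rw [Finset.sum_Ico_eq_sum_range, Nat.add_sub_cancel_left]
    simp only [add_comm]
  rw [hshift]
  symm
  apply Finset.sum_subset
  · intro c hc
    simp only [Finset.mem_Ico, Finset.mem_range] at hc ⊢
    omega
  · intro c _ hc
    simp only [Finset.mem_Ico] at hc
    exact hf c (by omega)

/-- The cyclic relabelling of columns bringing the window `N - d1, …, N` to the first block. -/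
def sitePerm (d1 d2 : ℕ) : Equiv.Perm (Fin (d1 + 1) ⊕ Fin (d2 + 1)) :=
  Equiv.swap (Sum.inl 0) (Sum.inr 0) * Equiv.Perm.sumCongr (finRotate (d1 + 1)) 1

lemma sign_sitePerm (d1 d2 : ℕ) :
    ((Equiv.Perm.sign (sitePerm d1 d2) : ℤ) : ℂ) = (-1) ^ (d1 + 1) := by
  simp [sitePerm, sign_finRotate, pow_succ]

lemma site_sitePerm_inl {d1 d2 : ℕ} (i : Fin (d1 + 1)) :
    site (sitePerm d1 d2 (Sum.inl i)) = i + 1 := by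
  rcases Fin.eq_castSucc_or_eq_last i with ⟨j, rfl⟩ | rfl
  · simp only [sitePerm, Equiv.Perm.mul_apply, Equiv.Perm.sumCongr_apply, Sum.map_inl,
      finRotate_apply, Fin.coeSucc_eq_succ]
    rw [Equiv.swap_apply_of_ne_of_ne (by simp [Fin.succ_ne_zero]) (by simp)]
    simp [site]
  · simp [sitePerm, site]

lemma site_sitePerm_inr {d1 d2 : ℕ} (k : Fin (d2 + 1)) :
    site (sitePerm d1 d2 (Sum.inr k)) = if k = 0 then 0 else d1 + 1 + (k : ℕ) := by
  split_ifs with h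
  · subst h
    simp [sitePerm, site]
  · simp only [sitePerm, Equiv.Perm.mul_apply, Equiv.Perm.sumCongr_apply, Sum.map_inr,
      Equiv.Perm.one_apply]
    rw [Equiv.swap_apply_of_ne_of_ne (by simp) (by simpa using h)]
    simp [site]

lemma sylvesterMat_mul_window_inl {d1 d2 : ℕ} {α β : ℤ → ℤ → ℂ} {γ : ℤ → ℂ} {N : ℤ} {x y : ℂ}
    (hu : IsUnit (aMat d1 β γ (N - 1) y).det) (hαγ : ∀ n, α (-1) n = γ n)
    (hαsupp : ∀ j n : ℤ, (j < -1 ∨ (d2 : ℤ) < j) → α j n = 0) (r i : Fin (d1 + 1)) :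
    ∑ s, sylvesterMat d1 d2 α β N x y (Sum.inl r) s * window d1 β γ N y (site s) 0 i =
      (x • (1 : Matrix (Fin (d1 + 1)) (Fin (d1 + 1)) ℂ) - D2Mat d1 d2 α β γ N y) r i := by
  have hr := r.2
  have key := sum_site (d1 := d1) (d2 := d2) (fun c => ((if c = (r : ℕ) + 1 then x else 0)
      - α ((c : ℤ) - ((r : ℕ) : ℤ) - 1) (N - 1 - (d1 : ℤ) + (c : ℤ))) * window d1 β γ N y c 0 i)
      r (d2 + 2) (by omega) (by
        intro c hc
        rw [if_neg (by omega), hαsupp _ _ (by omega)]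
        simp)
  refine key.trans ?_
  rw [Matrix.sub_apply, D2Mat_apply hu hαγ]
  simp only [sub_mul, Finset.sum_sub_distrib]
  congr 1
  · rw [Finset.sum_eq_single 1]
    · have := window_apply hu r hr 1 i
      simp only [Fin.eta] at this
      rw [if_pos (by omega), ← this]
      simp [window, aProd]
    · intro k _ hk
      rw [if_neg (by omega), zero_mul]
    · simp
  · refine Finset.sum_congr rfl fun k _ => ?_
    congr 2
    push_cast
    ring

lemma sylvesterMat_mul_window_inr {d1 d2 : ℕ} {α β : ℤ → ℤ → ℂ} {γ : ℤ → ℂ} {N : ℤ} {x y : ℂ}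
    (hu : IsUnit (aMat d1 β γ (N - 1) y).det) (hβγ : ∀ n, β (-1) n = γ n)
    (hγ : ∀ n, γ n ≠ 0) (hβsupp : ∀ j n : ℤ, (j < -1 ∨ (d1 : ℤ) < j) → β j n = 0)
    (j : Fin (d2 + 1)) (i : Fin (d1 + 1)) :
    ∑ s, sylvesterMat d1 d2 α β N x y (Sum.inr j) s * window d1 β γ N y (site s) 0 i = 0 := by
  have hj := j.2
  have key := sum_site (d1 := d1) (d2 := d2) (fun c => ((if c = (j : ℕ) + d1 then y else 0)
      - β ((d1 : ℤ) + ((j : ℕ) : ℤ) - (c : ℤ)) (N - 1 + ((j : ℕ) : ℤ)))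
        * window d1 β γ N y c 0 i)
      j (d1 + 2) (by omega) (by
        intro c hc
        rw [if_neg (by omega), hβsupp _ _ (by omega)]
        simp)
  refine key.trans ?_
  simp only [sub_mul, Finset.sum_sub_distrib]
  rw [sub_eq_zero, Finset.sum_eq_single d1]
  · rw [if_pos (by omega), add_comm d1 (j : ℕ), ← window_recurrence hu hβγ hγ]
    refine Finset.sum_congr rfl fun k _ => ?_
    rw [add_comm (j : ℕ) k]
    congr 2
    push_cast
    ring
  · intro k _ hk
    rw [if_neg (by omega), zero_mul]
  · simp

lemma det_sylvesterMat {d1 d2 : ℕ} {α β : ℤ → ℤ → ℂ} {γ : ℤ → ℂ} (hd1 : 1 ≤ d1)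
    (hαsupp : ∀ j n : ℤ, (j < -1 ∨ (d2 : ℤ) < j) → α j n = 0)
    (hβsupp : ∀ j n : ℤ, (j < -1 ∨ (d1 : ℤ) < j) → β j n = 0)
    (hαγ : ∀ n : ℤ, α (-1) n = γ n) (hβγ : ∀ n : ℤ, β (-1) n = γ n)
    (hγ : ∀ n : ℤ, γ n ≠ 0) (hβtop : ∀ n : ℤ, β d1 n ≠ 0) (N : ℤ) (x y : ℂ) :
    (sylvesterMat d1 d2 α β N x y).det = (-1) ^ (d1 + d2) *
      (β d1 (N - 1) * ∏ k ∈ Finset.range d2, γ (N + k)) *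
      (x • (1 : Matrix (Fin (d1 + 1)) (Fin (d1 + 1)) ℂ) - D2Mat d1 d2 α β γ N y).det := by
  have hu : IsUnit (aMat d1 β γ (N - 1) y).det := isUnit_det_aMat β γ (N - 1) y hd1 (hγ _) (hβtop _)
  set S := sylvesterMat d1 d2 α β N x y
  set e := sitePerm d1 d2 with he
  set T := S.submatrix id e with hT
  set G : Matrix (Fin (d1 + 1) ⊕ Fin (d2 + 1)) (Fin (d1 + 1)) ℂ :=
    Matrix.of fun s i => window d1 β γ N y (site (e s)) 0 i with hG
  have hTG : ∀ r i, (T * G) r i =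
      ∑ s, S r s * window d1 β γ N y (site s) 0 i := by
    intro r i
    rw [Matrix.mul_apply, ← Equiv.sum_comp e (fun s => S r s * window d1 β γ N y (site s) 0 i)]
    rfl
  have hG1 : ∀ r i : Fin (d1 + 1), G (Sum.inl r) i = (1 : Matrix _ _ ℂ) r i := by
    intro r i
    rw [hG, Matrix.of_apply, he, site_sitePerm_inl, add_comm, ← window_apply hu r r.2 1 i]
    rfl
  have hprod : T * fromBlocks 1 0 G.toRows₂ 1 = fromBlocks
      (x • (1 : Matrix (Fin (d1 + 1)) (Fin (d1 + 1)) ℂ) - D2Mat d1 d2 α β γ N y)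
      T.toBlocks₁₂ 0 T.toBlocks₂₂ := by
    have hGr : fromBlocks 1 0 G.toRows₂ 1 =
        fromCols G (fromRows 0 (1 : Matrix (Fin (d2 + 1)) (Fin (d2 + 1)) ℂ)) := by
      ext (r | r) (i | i) <;> simp [hG1]
    rw [hGr, mul_fromCols]
    ext (r | r) (i | i)
    · simp only [fromCols_apply_inl, fromBlocks_apply₁₁, hTG]
      exact sylvesterMat_mul_window_inl hu hαγ hαsupp r i
    · simp [Matrix.mul_apply, Matrix.one_apply, toBlocks₁₂]
    · simp only [fromCols_apply_inl, fromBlocks_apply₂₁, hTG]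
      exact sylvesterMat_mul_window_inr hu hβγ hγ hβsupp r i
    · simp [Matrix.mul_apply, Matrix.one_apply, toBlocks₂₂]
  have hdet := congrArg Matrix.det hprod
  rw [Matrix.det_mul, det_fromBlocks_zero₁₂, det_fromBlocks_zero₂₁, det_one, det_one, mul_one,
    mul_one, hT, Matrix.det_permute', sign_sitePerm, ← hT] at hdet
  have hentry : ∀ j k : Fin (d2 + 1), T.toBlocks₂₂ j k =
      (if site (e (Sum.inr k)) = (j : ℕ) + d1 then y else 0)
      - β ((d1 : ℤ) + ((j : ℕ) : ℤ) - (site (e (Sum.inr k)) : ℤ)) (N - 1 + ((j : ℕ) : ℤ)) :=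
    fun j k => rfl
  have hD : T.toBlocks₂₂.det = (-1) ^ (d2 + 1) *
      (β d1 (N - 1) * ∏ k ∈ Finset.range d2, γ (N + k)) := by
    rw [det_of_isLowerTriangular, Fin.prod_univ_succ, Finset.prod_range]
    · have h0 : T.toBlocks₂₂ 0 0 = -β d1 (N - 1) := by
        rw [hentry, he, site_sitePerm_inr, if_pos rfl, if_neg (by simp; omega)]
        simp
      have hk : ∀ k : Fin d2, T.toBlocks₂₂ k.succ k.succ = -γ (N + ((k : ℕ) : ℤ)) := by
        intro k
        rw [hentry, he, site_sitePerm_inr, if_neg (Fin.succ_ne_zero k),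
          if_neg (by omega), ← hβγ, zero_sub]
        congr 2 <;> simp
      rw [h0]
      simp only [hk]
      rw [Finset.prod_neg]
      simp
      ring
    · intro j k hjk
      have hjk' : (j : ℕ) < (k : ℕ) := by simpa using hjk
      have hk0 : k ≠ 0 := by rintro rfl; simp at hjk'
      rw [hentry, he, site_sitePerm_inr, if_neg hk0, if_neg (by omega), hβsupp _ _ (by omega),
        sub_zero]
  rw [hD] at hdet
  have hsign : (-1 : ℂ) ^ (d1 + 1) * (-1) ^ (d1 + 1) = 1 := by rw [← mul_pow]; simp
  calc S.det = (-1) ^ (d1 + 1) * ((-1) ^ (d1 + 1) * S.det) := by rw [← mul_assoc, hsign, one_mul]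
    _ = _ := by rw [hdet]; ring

/-- Reflection of the site lattice on the coefficients `α_j(n)`. -/
def reflect (a : ℤ → ℤ → ℂ) (j n : ℤ) : ℂ := a j (j - n)

lemma det_sylvesterMat_reflect (d1 d2 : ℕ) (α β : ℤ → ℤ → ℂ) (N : ℤ) (x y : ℂ) :
    (sylvesterMat d2 d1 (reflect β) (reflect α) (1 - N) y x).det =
      (sylvesterMat d1 d2 α β N x y).det := by
  set σ : Fin (d2 + 1) ⊕ Fin (d1 + 1) ≃ Fin (d1 + 1) ⊕ Fin (d2 + 1) :=
    (Equiv.sumCongr Fin.revPerm Fin.revPerm).trans (Equiv.sumComm _ _) with hσ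
  have hsite : ∀ s, (site (σ s) : ℤ) = d1 + d2 + 1 - site s := by
    rintro (i | i) <;> simp [hσ, site, Fin.val_rev] <;> omega
  rw [← Matrix.det_submatrix_equiv_self σ]
  congr 1
  ext r s
  have hs := hsite s
  rcases r with i | i
  · have hi := i.2
    have hr : σ (Sum.inl i) = Sum.inr (Fin.rev i) := rfl
    simp only [sylvesterMat, Matrix.of_apply, Matrix.submatrix_apply, hr, Sum.elim_inl,
      Sum.elim_inr, reflect, hs, Fin.val_rev]
    congr 1
    · exact if_congr (by omega) rfl rfl
    · congr 1 <;> omega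
  · have hi := i.2
    have hr : σ (Sum.inr i) = Sum.inl (Fin.rev i) := rfl
    simp only [sylvesterMat, Matrix.of_apply, Matrix.submatrix_apply, hr, Sum.elim_inl,
      Sum.elim_inr, reflect, hs, Fin.val_rev]
    congr 1
    · exact if_congr (by omega) rfl rfl
    · congr 1 <;> omega

/-- Transposition along the antidiagonal. -/
def antiTranspose {d : ℕ} (A : Matrix (Fin (d + 1)) (Fin (d + 1)) ℂ) :
    Matrix (Fin (d + 1)) (Fin (d + 1)) ℂ :=
  Aᵀ.submatrix Fin.revPerm Fin.revPerm

lemma antiTranspose_mul {d : ℕ} (A B : Matrix (Fin (d + 1)) (Fin (d + 1)) ℂ) :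
    antiTranspose (A * B) = antiTranspose B * antiTranspose A := by
  simp [antiTranspose, Matrix.transpose_mul, Matrix.submatrix_mul_equiv]

lemma antiTranspose_inv {d : ℕ} (A : Matrix (Fin (d + 1)) (Fin (d + 1)) ℂ) :
    antiTranspose A⁻¹ = (antiTranspose A)⁻¹ := by
  simp [antiTranspose, Matrix.transpose_nonsing_inv, Matrix.inv_submatrix_equiv]

lemma antiTranspose_one {d : ℕ} :
    antiTranspose (1 : Matrix (Fin (d + 1)) (Fin (d + 1)) ℂ) = 1 := by
  simp [antiTranspose]

lemma antiTranspose_diagonal {d : ℕ} (f : Fin (d + 1) → ℂ) :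
    antiTranspose (Matrix.diagonal f) = Matrix.diagonal fun i => f (Fin.rev i) := by
  simp only [antiTranspose, Matrix.diagonal_transpose, Matrix.submatrix_diagonal_equiv]
  rfl

lemma det_antiTranspose {d : ℕ} (A : Matrix (Fin (d + 1)) (Fin (d + 1)) ℂ) :
    (antiTranspose A).det = A.det := by
  rw [antiTranspose, Matrix.det_submatrix_equiv_self, Matrix.det_transpose]

lemma antiTranspose_abarMat (d : ℕ) (α : ℤ → ℤ → ℂ) (γ : ℤ → ℂ) (n : ℤ) (x : ℂ) :
    antiTranspose (abarMat d α γ n x) =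
      aMat d (reflect α) (fun m => γ (-m - 1)) (-n) x := by
  ext i b
  have hi := i.2
  have hb := b.2
  simp only [antiTranspose, abarMat, aMat, Matrix.submatrix_apply, Matrix.transpose_apply,
    Matrix.of_apply, Fin.revPerm_apply, Fin.val_rev, reflect, neg_neg]
  by_cases hid : (i : ℕ) < d
  · rw [if_neg (by omega), if_pos hid]
    exact if_congr (by omega) rfl rfl
  · rw [if_pos (by omega), if_neg hid]
    by_cases hbd : (b : ℕ) = d
    · rw [if_pos (by omega), if_pos hbd, zero_sub, neg_neg]
    · rw [if_neg (by omega), if_neg hbd,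
        show ((d + 1 - ((b : ℕ) + 1) : ℕ) : ℤ) = (d : ℤ) - ((b : ℕ) : ℤ) by omega]
      congr 3
      ring

lemma antiTranspose_abarProd (d : ℕ) (α : ℤ → ℤ → ℂ) (γ : ℤ → ℂ) (N : ℤ) (x : ℂ) (j : ℕ) :
    antiTranspose (abarProd d α γ N x j) =
      aProd d (reflect α) (fun m => γ (-m - 1)) (1 - N) x j := by
  induction j with
  | zero => exact antiTranspose_one
  | succ j ih =>
    rw [abarProd, aProd, antiTranspose_mul, ih, antiTranspose_abarMat,
      show -(N - 1 - (j : ℤ)) = 1 - N + j by ring]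

lemma antiTranspose_D1barMat (d1 d2 : ℕ) (α β : ℤ → ℤ → ℂ) (γ : ℤ → ℂ) (N : ℤ) (x : ℂ) :
    antiTranspose (D1barMat d1 d2 α β γ N x) =
      D2Mat d2 d1 (reflect β) (reflect α) (fun m => γ (-m - 1)) (1 - N) x := by
  have hadd : ∀ A B : Matrix (Fin (d2 + 1)) (Fin (d2 + 1)) ℂ,
      antiTranspose (A + B) = antiTranspose A + antiTranspose B := fun _ _ => rfl
  have hsum : ∀ f : ℕ → Matrix (Fin (d2 + 1)) (Fin (d2 + 1)) ℂ,
      antiTranspose (∑ j ∈ Finset.Icc 1 d1, f j) =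
        ∑ j ∈ Finset.Icc 1 d1, antiTranspose (f j) := by
    intro f
    ext i b
    simp [antiTranspose, Matrix.sum_apply]
  simp only [D1barMat, D2Mat, hadd, hsum, antiTranspose_mul, antiTranspose_inv,
    antiTranspose_abarProd, antiTranspose_abarMat, antiTranspose_diagonal, reflect]
  have hrev : ∀ i : Fin (d2 + 1), ((Fin.rev i : ℕ) : ℤ) = d2 - ((i : ℕ) : ℤ) := by
    intro i
    have := i.2
    rw [Fin.val_rev]
    omega
  simp only [hrev]
  congr 1
  · congr 1
    · congr 2
      · funext i; congr 1; ring
      · congr 1; ring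
    · congr 1; funext i; congr 1; ring
  · refine Finset.sum_congr rfl fun j _ => ?_
    congr 2; funext i; congr 1; ring

/-- Spectral duality:
`u·det(x·1 − D2_N(y)) = v·det(y·1 − D̲1_N(x))`. -/
theorem spectral_duality_D2_D1bar (d1 d2 : ℕ) (hd1 : 1 ≤ d1) (hd2 : 1 ≤ d2)
    (α β : ℤ → ℤ → ℂ) (γ : ℤ → ℂ)
    (hαsupp : ∀ j n : ℤ, (j < -1 ∨ (d2 : ℤ) < j) → α j n = 0)
    (hβsupp : ∀ j n : ℤ, (j < -1 ∨ (d1 : ℤ) < j) → β j n = 0)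
    (hαγ : ∀ n : ℤ, α (-1) n = γ n)
    (hβγ : ∀ n : ℤ, β (-1) n = γ n)
    (hγ : ∀ n : ℤ, γ n ≠ 0)
    (u v : ℂ) (hu : u ≠ 0) (hv : v ≠ 0)
    (hαtop : ∀ n : ℤ, α (d2 : ℤ) n = v * ∏ j ∈ Finset.Icc 1 d2, γ (n - (j : ℤ)))
    (hβtop : ∀ n : ℤ, β (d1 : ℤ) n = u * ∏ j ∈ Finset.Icc 1 d1, γ (n - (j : ℤ)))
    (N : ℤ) (x y : ℂ) :
    u * (x • (1 : Matrix (Fin (d1 + 1)) (Fin (d1 + 1)) ℂ)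
          - D2Mat d1 d2 α β γ N y).det =
      v * (y • (1 : Matrix (Fin (d2 + 1)) (Fin (d2 + 1)) ℂ)
          - D1barMat d1 d2 α β γ N x).det := by
  have hβne : ∀ n : ℤ, β d1 n ≠ 0 := fun n => by
    rw [hβtop]
    exact mul_ne_zero hu (Finset.prod_ne_zero_iff.mpr fun _ _ => hγ _)
  have hαne : ∀ n : ℤ, α d2 n ≠ 0 := fun n => by
    rw [hαtop]
    exact mul_ne_zero hv (Finset.prod_ne_zero_iff.mpr fun _ _ => hγ _)
  have h1 := det_sylvesterMat hd1 hαsupp hβsupp hαγ hβγ hγ hβne N x y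
  have h2 := det_sylvesterMat (d1 := d2) (d2 := d1) (α := reflect β) (β := reflect α)
    (γ := fun m => γ (-m - 1)) hd2 (fun j n h => hβsupp j _ h) (fun j n h => hαsupp j _ h)
    (fun n => by rw [reflect, hβγ]; congr 1; ring) (fun n => by rw [reflect, hαγ]; congr 1; ring)
    (fun n => hγ _) (fun n => hαne _) (1 - N) y x
  rw [det_sylvesterMat_reflect, ← antiTranspose_D1barMat,
    show y • (1 : Matrix (Fin (d2 + 1)) (Fin (d2 + 1)) ℂ)
        - antiTranspose (D1barMat d1 d2 α β γ N x)
      = antiTranspose (y • (1 : Matrix (Fin (d2 + 1)) (Fin (d2 + 1)) ℂ)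
        - D1barMat d1 d2 α β γ N x) by
      conv_lhs => rw [← antiTranspose_one]
      rfl,
    det_antiTranspose, h1] at h2
  set P := ∏ k ∈ Finset.range d2, γ (N + k) with hP
  set Q := ∏ k ∈ Finset.range d1, γ (-(1 - N + (k : ℤ)) - 1) with hQ
  have hβ' : β d1 (N - 1) = u * Q := by
    rw [hβtop, ← Finset.Ico_add_one_right_eq_Icc, Finset.prod_Ico_eq_prod_range,
      Nat.add_sub_cancel, hQ]
    congr 1
    refine Finset.prod_congr rfl fun k _ => ?_
    congr 1
    push_cast
    ring
  have hα' : reflect α d2 (1 - N - 1) = v * P := by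
    rw [reflect, hαtop, ← Finset.Ico_add_one_right_eq_Icc, Finset.prod_Ico_eq_prod_range,
      Nat.add_sub_cancel, hP, ← Finset.prod_range_reflect]
    congr 1
    refine Finset.prod_congr rfl fun k hk => ?_
    have := Finset.mem_range.mp hk
    congr 1
    omega
  have hP0 : P ≠ 0 := Finset.prod_ne_zero_iff.mpr fun _ _ => hγ _
  have hQ0 : Q ≠ 0 := Finset.prod_ne_zero_iff.mpr fun _ _ => hγ _
  have hs0 : (-1 : ℂ) ^ (d1 + d2) ≠ 0 := pow_ne_zero _ (by norm_num)
  rw [hβ', hα', add_comm d2 d1] at h2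
  apply mul_left_cancel₀ (mul_ne_zero hs0 (mul_ne_zero hP0 hQ0))
  linear_combination h2
end

section
/- Let ψ̄_n : ℂ → ℂ and φ_n : ℂ → ℂ (n ∈ ℤ) be differentiable functions satisfying, for all n ∈ ℤ and all points of ℂ: (i) y·ψ̄_n(y) = Σ_{j=−1}^{d1} β_j(n+j)·ψ̄_{n+j}(y); (ii) ψ̄_n′(y) = Σ_{l=−1}^{d2} α_l(n)·ψ̄_{n−l}(y); (iii) y·φ_n(y) = Σ_{j=−1}^{d1} β_j(n)·φ_{n−j}(y); (iv) φ_n′(y) = −γ(n−1)·φ_{n−1}(y) − Σ_{j=0}^{d2} α_j(n+j)·φ_{n+j}(y). Define f_N(y) := −γ(N−1)·ψ̄_{N−1}(y)·φ_N(y) + Σ_{j=1}^{d1} Σ_{k=0}^{j−1} β_j(N+k)·ψ̄_{N+k}(y)·φ_{N−j+k}(y). Then f_N(y) is independent of both y and N: there exists a constant c ∈ ℂ such that f_N(y) = c for all N ∈ ℤ and all y ∈ ℂ. -/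
open BigOperators
open Filter

/-- A non-archimedean size function on a complex vector space, trivial on scalars, which the
operator `Y` doubles. -/
structure DoublingNorm {E : Type*} [AddCommGroup E] [Module ℂ E] (Y : E → E) (N : E → ℝ) :
    Prop where
  nonneg : ∀ x, 0 ≤ N x
  zero : N 0 = 0
  add_le : ∀ x y, N (x + y) ≤ max (N x) (N y)
  smul : ∀ (c : ℂ) (x : E), c ≠ 0 → N (c • x) = N x
  map : ∀ x, N (Y x) = 2 * N x

namespace DoublingNorm

variable {E : Type*} [AddCommGroup E] [Module ℂ E] {Y : E → E} {N : E → ℝ}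

lemma smul_le (hN : DoublingNorm Y N) (c : ℂ) (x : E) : N (c • x) ≤ N x := by
  by_cases hc : c = 0
  · simp [hc, hN.zero, hN.nonneg]
  · exact (hN.smul c x hc).le

lemma neg (hN : DoublingNorm Y N) (x : E) : N (-x) = N x := by
  simpa using hN.smul (-1) x (by simp)

lemma le_of_mem_span (hN : DoublingNorm Y N) {s : Set E} {r : ℝ} (hr : 0 ≤ r)
    (hs : ∀ x ∈ s, N x ≤ r) {x : E} (hx : x ∈ Submodule.span ℂ s) : N x ≤ r := by
  induction hx using Submodule.span_induction with
  | mem x h => exact hs x h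
  | zero => rw [hN.zero]; exact hr
  | add x y _ _ hx hy => exact (hN.add_le x y).trans (max_le hx hy)
  | smul c x _ hx => exact (hN.smul_le c x).trans hx

lemma add_eq_left (hN : DoublingNorm Y N) {x y : E} (h : N y < N x) : N (x + y) = N x := by
  apply le_antisymm
  · simpa [max_eq_left h.le] using hN.add_le x y
  · by_contra! hlt
    have h1 := hN.add_le (x + y) (-y)
    rw [add_neg_cancel_right, hN.neg] at h1
    exact absurd h1 (not_le.mpr (max_lt hlt h))

/-- If the sizes of a family at least double at each step to the left, then nonzero combinations
are at least as large as the rightmost member. -/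
lemma le_of_mem_span_of_doubling (hN : DoublingNorm Y N) (x : ℤ → E) (m : ℤ)
    (hpos : 0 < N (x m)) (hlt : ∀ n n', n < n' → n' ≤ m → N (x n') < N (x n))
    {h : E} (hh : h ∈ Submodule.span ℂ (x '' Set.Iic m)) (h0 : N h ≠ 0) :
    N (x m) ≤ N h := by
  obtain ⟨l, hl, rfl⟩ := (Finsupp.mem_span_image_iff_linearCombination ℂ).1 hh
  rw [Finsupp.mem_supported] at hl
  have hne : l.support.Nonempty := by
    rw [Finsupp.support_nonempty_iff]
    rintro rfl
    exact h0 (by simp [hN.zero])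
  set n := l.support.min' hne with hn
  have hnm : n ∈ l.support := Finset.min'_mem _ _
  have hle : ∀ n' ≤ m, N (x m) ≤ N (x n') := fun n' h' => by
    rcases h'.eq_or_lt with rfl | h'
    · rfl
    · exact (hlt _ _ h' le_rfl).le
  have hnle : n ≤ m := hl hnm
  rw [Finsupp.linearCombination_apply, Finsupp.sum, ← Finset.add_sum_erase _ _ hnm]
  have hcn := hN.smul (l n) (x n) (by simpa using hnm)
  have hrest : N (∑ i ∈ l.support.erase n, l i • x i) < N (l n • x n) := by
    rw [hcn]
    refine Finset.sum_induction _ (fun v => N v < N (x n))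
      (fun a b ha hb => (hN.add_le a b).trans_lt (max_lt ha hb)) ?_ ?_
    · simpa [hN.zero] using hpos.trans_le (hle n hnle)
    · intro i hi
      obtain ⟨hi1, hi2⟩ := Finset.mem_erase.1 hi
      exact (hN.smul_le _ _).trans_lt
        (hlt _ _ (lt_of_le_of_ne (Finset.min'_le _ _ hi2) (Ne.symm hi1)) (hl hi2))
  rw [hN.add_eq_left hrest, hcn]
  exact hle n hnle

/-- For a sequence whose `Y`-multiples reach back by at most one step, no element of nonzero size
lies in the span of every left tail. -/
lemma eq_zero_of_forall_mem_span (hN : DoublingNorm Y N) (x : ℤ → E) (γ : ℤ → ℂ) (d : ℕ)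
    (hx : ∀ n, ∃ r ∈ Submodule.span ℂ (x '' Set.Icc n (n + d)),
      Y (x n) = γ n • x (n - 1) + r)
    {h : E} (hh : ∀ k : ℤ, h ∈ Submodule.span ℂ (x '' Set.Iic k)) : N h = 0 := by
  by_cases hdom : ∃ n, 0 < N (x n) ∧ ∀ i ∈ Set.Icc n (n + d), N (x i) < 2 * N (x n)
  · obtain ⟨n, hpos, hn⟩ := hdom
    have key : ∀ k : ℕ, N (x (n - k)) = 2 ^ k * N (x n) ∧
        ∀ i ∈ Set.Icc (n - k) (n - k + d), N (x i) < 2 * N (x (n - k)) := by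
      intro k
      induction k with
      | zero => simpa using hn
      | succ k ih =>
        obtain ⟨ih1, ih2⟩ := ih
        set a := n - (k : ℤ) with ha
        have hpa : 0 < N (x a) := by rw [ih1]; positivity
        obtain ⟨r, hr, hrec⟩ := hx a
        have hne : (Finset.Icc a (a + d)).Nonempty := ⟨a, by simp⟩
        obtain ⟨b, hb, hbmax⟩ := Finset.exists_max_image (Finset.Icc a (a + d))
          (fun i => N (x i)) hne
        have hrN : N r < 2 * N (x a) := by
          refine (hN.le_of_mem_span (hN.nonneg (x b)) ?_ hr).trans_lt (ih2 b (by simpa using hb))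
          rintro _ ⟨i, hi, rfl⟩
          exact hbmax i (by simpa using hi)
        have h1 : N (γ a • x (a - 1)) = 2 * N (x a) := by
          rw [eq_sub_of_add_eq hrec.symm, sub_eq_add_neg, hN.add_eq_left, hN.map]
          rwa [hN.neg, hN.map]
        have hγ : γ a ≠ 0 := by
          intro h0
          rw [h0, zero_smul, hN.zero] at h1
          linarith
        rw [hN.smul _ _ hγ] at h1
        have ha1 : n - ((k + 1 : ℕ) : ℤ) = a - 1 := by push_cast; omega
        rw [ha1]
        refine ⟨by rw [h1, ih1]; ring, fun i hi => ?_⟩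
        rw [h1]
        rcases eq_or_ne i (a - 1) with rfl | hi'
        · rw [h1]; linarith
        · have := ih2 i ⟨by have := hi.1; omega, by have := hi.2; omega⟩
          linarith
    have hval : ∀ i ≤ n, N (x i) = 2 ^ (n - i).toNat * N (x n) := fun i hi => by
      have := (key (n - i).toNat).1
      rwa [Int.toNat_of_nonneg (by omega), sub_sub_cancel] at this
    by_contra hne
    obtain ⟨k, hk⟩ := pow_unbounded_of_one_lt (N h / N (x n)) (one_lt_two (α := ℝ))
    rw [div_lt_iff₀ hpos] at hk
    refine absurd (hN.le_of_mem_span_of_doubling x (n - k) ?_ ?_ (hh (n - k)) hne) ?_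
    · rw [(key k).1]; positivity
    · intro i j hij hj
      rw [hval i (by omega), hval j (by omega)]
      gcongr
      · norm_num
      · omega
    · rw [(key k).1]; exact not_le.mpr hk
  · push Not at hdom
    obtain ⟨B, hB0, hB⟩ : ∃ B : ℝ, 0 ≤ B ∧ ∀ i ∈ Set.Icc (0 : ℤ) (0 + d), N (x i) ≤ B := by
      obtain ⟨b, -, hb⟩ := Finset.exists_max_image (Finset.Icc (0 : ℤ) (0 + d))
        (fun i => N (x i)) ⟨0, by simp⟩
      exact ⟨N (x b), hN.nonneg _, fun i hi => hb i (by simpa using hi)⟩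
    have step : ∀ (m : ℤ) (C : ℝ), 0 ≤ C → (∀ i ∈ Set.Icc m (m + d), N (x i) ≤ C) →
        ∀ k : ℕ, N (x (m - 1 - k)) ≤ C / 2 := by
      intro m C hC hm k
      induction k using Nat.strong_induction_on with
      | _ k ih =>
        rcases (hN.nonneg (x (m - 1 - k))).eq_or_lt with h0 | hpos
        · rw [← h0]; positivity
        · obtain ⟨i, hi, hile⟩ := hdom _ hpos
          have hi1 := hi.1
          have hi2 := hi.2
          rcases eq_or_ne i (m - 1 - k) with rfl | hne
          · linarith
          · rcases le_or_gt m i with hmi | him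
            · have := hm i ⟨hmi, by omega⟩
              linarith
            · have := ih (m - 1 - i).toNat (by omega)
              rw [Int.toNat_of_nonneg (by omega), sub_sub_cancel] at this
              linarith
    have tail : ∀ k : ℕ, ∃ m : ℤ, ∀ i ≤ m + d, N (x i) ≤ B / 2 ^ (k + 1) := by
      intro k
      induction k with
      | zero =>
        refine ⟨-1 - d, fun i hi => ?_⟩
        have := step 0 B hB0 hB (-1 - i).toNat
        rw [Int.toNat_of_nonneg (by omega)] at this
        simpa using this
      | succ k ih =>
        obtain ⟨m, hm⟩ := ih
        refine ⟨m - 1 - d, fun i hi => ?_⟩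
        have := step m _ (by positivity) (fun i hi => hm i hi.2) (m - 1 - i).toNat
        rw [Int.toNat_of_nonneg (by omega), sub_sub_cancel] at this
        rwa [pow_succ, ← div_div]
    by_contra hne
    have hpos : 0 < N h := lt_of_le_of_ne (hN.nonneg h) (Ne.symm hne)
    obtain ⟨k, hk⟩ := pow_unbounded_of_one_lt (B / N h) (one_lt_two (α := ℝ))
    obtain ⟨m, hm⟩ := tail k
    have hle : N h ≤ B / 2 ^ (k + 1) := by
      refine hN.le_of_mem_span (by positivity) ?_ (hh (m + d))
      rintro _ ⟨i, hi, rfl⟩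
      exact hm i hi
    rw [div_lt_iff₀ hpos] at hk
    rw [le_div_iff₀ (by positivity), pow_succ] at hle
    nlinarith [mul_pos hpos (pow_pos (two_pos (α := ℝ)) k)]

end DoublingNorm

/-- The absolute value at infinity on rational functions, normalised by `|X| = 2`. -/
noncomputable def ratFuncAbs (a : RatFunc ℂ) : NNReal :=
  open Classical in if a = 0 then 0 else 2 ^ a.intDegree

lemma ratFuncAbs_zero : ratFuncAbs 0 = 0 := by simp [ratFuncAbs]

lemma ratFuncAbs_of_ne_zero {a : RatFunc ℂ} (ha : a ≠ 0) : ratFuncAbs a = 2 ^ a.intDegree := by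
  simp [ratFuncAbs, ha]

lemma ratFuncAbs_eq_zero {a : RatFunc ℂ} : ratFuncAbs a = 0 ↔ a = 0 := by
  refine ⟨fun h => ?_, fun h => h ▸ ratFuncAbs_zero⟩
  by_contra ha
  rw [ratFuncAbs_of_ne_zero ha] at h
  exact zpow_ne_zero _ two_ne_zero h

lemma ratFuncAbs_mul (a b : RatFunc ℂ) : ratFuncAbs (a * b) = ratFuncAbs a * ratFuncAbs b := by
  by_cases ha : a = 0
  · simp [ha, ratFuncAbs_zero]
  by_cases hb : b = 0
  · simp [hb, ratFuncAbs_zero]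
  rw [ratFuncAbs_of_ne_zero ha, ratFuncAbs_of_ne_zero hb, ratFuncAbs_of_ne_zero (mul_ne_zero ha hb),
    RatFunc.intDegree_mul ha hb, zpow_add₀ two_ne_zero]

lemma ratFuncAbs_add_le (a b : RatFunc ℂ) :
    ratFuncAbs (a + b) ≤ max (ratFuncAbs a) (ratFuncAbs b) := by
  by_cases ha : a = 0
  · simp [ha]
  by_cases hb : b = 0
  · simp [hb]
  by_cases hab : a + b = 0
  · simp [hab, ratFuncAbs_zero]
  rw [ratFuncAbs_of_ne_zero ha, ratFuncAbs_of_ne_zero hb, ratFuncAbs_of_ne_zero hab]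
  rcases le_max_iff.1 (RatFunc.intDegree_add_le hb hab) with h | h
  · exact (zpow_le_zpow_right₀ one_le_two h).trans (le_max_left _ _)
  · exact (zpow_le_zpow_right₀ one_le_two h).trans (le_max_right _ _)

/-- Every vector space over the rational functions carries a norm compatible with
`ratFuncAbs`. -/
lemma exists_ratFunc_norm (E : Type*) [AddCommGroup E] [Module (RatFunc ℂ) E] :
    ∃ N : E → NNReal, (∀ x, N x = 0 ↔ x = 0) ∧ (∀ x y, N (x + y) ≤ max (N x) (N y)) ∧
      ∀ (a : RatFunc ℂ) (x : E), N (a • x) = ratFuncAbs a * N x := by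
  let b := Module.Basis.ofVectorSpace (RatFunc ℂ) E
  let N : E → NNReal := fun x => (b.repr x).support.sup fun i => ratFuncAbs (b.repr x i)
  have hle : ∀ x r, N x ≤ r ↔ ∀ i, ratFuncAbs (b.repr x i) ≤ r := by
    intro x r
    rw [Finset.sup_le_iff]
    refine ⟨fun h i => ?_, fun h i _ => h i⟩
    by_cases hi : b.repr x i = 0
    · simp [hi, ratFuncAbs_zero]
    · exact h i (by simpa using hi)
  have hmul : ∀ (a : RatFunc ℂ) (x : E), N (a • x) ≤ ratFuncAbs a * N x := by
    intro a x
    rw [hle]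
    intro i
    rw [map_smul, Finsupp.smul_apply, smul_eq_mul, ratFuncAbs_mul]
    gcongr
    exact (hle x _).1 le_rfl i
  have hzero : ∀ x, N x = 0 ↔ x = 0 := by
    intro x
    rw [← nonpos_iff_eq_zero, hle]
    simp only [nonpos_iff_eq_zero, ratFuncAbs_eq_zero]
    rw [← b.repr.map_eq_zero_iff, Finsupp.ext_iff]
    rfl
  refine ⟨N, hzero, fun x y => ?_, fun a x => le_antisymm (hmul a x) ?_⟩
  · rw [hle]
    intro i
    rw [map_add, Finsupp.add_apply]
    exact (ratFuncAbs_add_le _ _).trans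
      (max_le_max ((hle x _).1 le_rfl i) ((hle y _).1 le_rfl i))
  · by_cases ha : a = 0
    · simp [ha, ratFuncAbs_zero]
    calc ratFuncAbs a * N x = ratFuncAbs a * N (a⁻¹ • a • x) := by rw [inv_smul_smul₀ ha]
      _ ≤ ratFuncAbs a * (ratFuncAbs a⁻¹ * N (a • x)) := by gcongr; exact hmul _ _
      _ = N (a • x) := by
        rw [← mul_assoc, ← ratFuncAbs_mul, mul_inv_cancel₀ ha, ratFuncAbs_of_ne_zero one_ne_zero]
        simp

/-- Polynomials as germs of functions off finite sets. -/
noncomputable def polynomialGerm : Polynomial ℂ →+* Germ (cofinite : Filter ℂ) ℂ :=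
  (Germ.coeRingHom cofinite).comp (RingHom.pi fun z => Polynomial.evalRingHom z)

lemma isUnit_polynomialGerm {p : Polynomial ℂ} (hp : p ≠ 0) : IsUnit (polynomialGerm p) := by
  refine IsUnit.of_mul_eq_one (((fun z => (p.eval z)⁻¹ : ℂ → ℂ) : Germ (cofinite : Filter ℂ) ℂ)) ?_
  refine Germ.coe_eq.2 ?_
  have hfin : {z : ℂ | p.eval z = 0}.Finite := by
    simpa [Polynomial.IsRoot] using Polynomial.finite_setOfPred_isRoot hp
  filter_upwards [hfin.compl_mem_cofinite] with z hz
  exact mul_inv_cancel₀ hz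

/-- Rational functions as germs of functions off finite sets. -/
noncomputable def ratFuncGerm : RatFunc ℂ →+* Germ (cofinite : Filter ℂ) ℂ :=
  IsLocalization.lift (M := nonZeroDivisors (Polynomial ℂ)) (g := polynomialGerm)
    fun p => isUnit_polynomialGerm (nonZeroDivisors.ne_zero p.2)

lemma ratFuncGerm_algebraMap (p : Polynomial ℂ) :
    ratFuncGerm (algebraMap (Polynomial ℂ) (RatFunc ℂ) p) = polynomialGerm p :=
  IsLocalization.lift_eq _ p

/-- Complex functions carry a non-archimedean size, vanishing only on functions that are zero off a
finite set, which multiplication by the variable doubles. -/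
lemma exists_doublingNorm :
    ∃ N : (ℂ → ℂ) → ℝ, DoublingNorm (fun f z => z * f z) N ∧
      ∀ f, N f = 0 → f =ᶠ[cofinite] 0 := by
  let : Module (RatFunc ℂ) (Germ (cofinite : Filter ℂ) ℂ) := Module.compHom _ ratFuncGerm
  obtain ⟨N, hN0, hNadd, hNmul⟩ := exists_ratFunc_norm (Germ (cofinite : Filter ℂ) ℂ)
  have hpoly : ∀ (p : Polynomial ℂ) (f : ℂ → ℂ), p ≠ 0 →
      N ((fun z => p.eval z * f z : ℂ → ℂ) : Germ (cofinite : Filter ℂ) ℂ) =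
        2 ^ p.natDegree * N (f : Germ (cofinite : Filter ℂ) ℂ) := by
    intro p f hp
    have h1 := hNmul (algebraMap (Polynomial ℂ) (RatFunc ℂ) p) f
    rw [ratFuncAbs_of_ne_zero (by simpa using hp), RatFunc.intDegree_polynomial,
      zpow_natCast] at h1
    rw [← h1]
    change _ = N (ratFuncGerm _ * _)
    rw [ratFuncGerm_algebraMap]
    rfl
  refine ⟨fun f => N (f : Germ (cofinite : Filter ℂ) ℂ),
    ⟨fun _ => NNReal.coe_nonneg _, ?_, ?_, ?_, ?_⟩, ?_⟩
  · simpa using (hN0 0).2 rfl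
  · intro f g
    exact_mod_cast hNadd f g
  · intro c f hc
    simpa [Pi.smul_def] using hpoly (Polynomial.C c) f (by simpa using hc)
  · intro f
    have := hpoly Polynomial.X f Polynomial.X_ne_zero
    simp only [Polynomial.eval_X, Polynomial.natDegree_X, pow_one] at this
    simp [this]
  · intro f hf
    exact Germ.coe_eq.1 ((hN0 f).1 (NNReal.coe_eq_zero.1 hf))

lemma eq_zero_of_eventuallyEq_cofinite {f : ℂ → ℂ} (hf : Continuous f) (h : f =ᶠ[cofinite] 0) :
    f = 0 := by
  refine hf.ext_on (s := {z | f z = 0}) ?_ continuous_const fun z hz => hz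
  refine (dense_univ.sdiff_finite (t := {z : ℂ | ¬ f z = 0}) h).mono fun z hz => ?_
  simpa using hz.2

/-- The bilinear pairing of two sequences, meaningful when `x` has finite support. -/
noncomputable def seqPairing (a x : ℤ → ℂ) : ℂ := ∑ᶠ n, a n * x n

/-- Finitely supported sequences. -/
def FinSupp (x : ℤ → ℂ) : Prop := ∃ R : ℤ, ∀ n, R < |n| → x n = 0

lemma FinSupp.sub {x y : ℤ → ℂ} (hx : FinSupp x) (hy : FinSupp y) : FinSupp (x - y) := by
  obtain ⟨R, hR⟩ := hx
  obtain ⟨R', hR'⟩ := hy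
  exact ⟨max R R', fun n hn => by
    simp [hR n ((le_max_left _ _).trans_lt hn), hR' n ((le_max_right _ _).trans_lt hn)]⟩

lemma finSupp_of_Icc {x : ℤ → ℂ} {a b : ℤ} (h : ∀ n, n ∉ Finset.Icc a b → x n = 0) :
    FinSupp x := by
  refine ⟨|a| + |b|, fun n hn => h n fun hmem => ?_⟩
  rw [Finset.mem_Icc] at hmem
  rcases abs_cases n with ⟨h1, _⟩ | ⟨h1, _⟩ <;> rcases abs_cases a with ⟨h2, _⟩ | ⟨h2, _⟩ <;>
    rcases abs_cases b with ⟨h3, _⟩ | ⟨h3, _⟩ <;> omega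

lemma seqPairing_eq_sum (a : ℤ → ℂ) {x : ℤ → ℂ} {s : Finset ℤ} (h : ∀ n, n ∉ s → x n = 0) :
    seqPairing a x = ∑ n ∈ s, a n * x n := by
  refine finsum_eq_sum_of_support_subset _ fun n hn => ?_
  by_contra hns
  exact hn (by simp [h n hns])

lemma FinSupp.hasFiniteSupport {x : ℤ → ℂ} (hx : FinSupp x) (a : ℤ → ℂ) :
    (Function.support fun n => a n * x n).Finite := by
  obtain ⟨R, hR⟩ := hx
  refine (Set.finite_Icc (-R) R).subset fun n hn => ?_
  rw [Set.mem_Icc, ← abs_le]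
  by_contra h
  exact hn (by simp [hR n (not_le.1 h)])

lemma seqPairing_sub (a : ℤ → ℂ) {x y : ℤ → ℂ} (hx : FinSupp x) (hy : FinSupp y) :
    seqPairing a (x - y) = seqPairing a x - seqPairing a y := by
  simp only [seqPairing, Pi.sub_apply, mul_sub]
  exact finsum_sub_distrib (hx.hasFiniteSupport a) (hy.hasFiniteSupport a)

lemma seqPairing_smul (a : ℤ → ℂ) (c : ℂ) (x : ℤ → ℂ) :
    seqPairing a (c • x) = c * seqPairing a x := by
  simp only [seqPairing, Pi.smul_apply, smul_eq_mul]
  rw [mul_finsum (fun n => a n * x n) c]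
  exact finsum_congr fun n => by ring

/-- Truncation of a sequence to the indices below `N`. -/
noncomputable def cut (N : ℤ) : Module.End ℂ (ℤ → ℂ) where
  toFun x n := if n < N then x n else 0
  map_add' x y := by ext n; by_cases h : n < N <;> simp [h]
  map_smul' c x := by ext n; by_cases h : n < N <;> simp [h]

lemma cut_apply (N : ℤ) (x : ℤ → ℂ) (n : ℤ) : cut N x n = if n < N then x n else 0 := rfl

/-- Operators on sequences whose output at `n` depends only on the input within distance `w`
of `n`. -/
def IsLocal (w : ℤ) (T : Module.End ℂ (ℤ → ℂ)) : Prop :=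
  0 ≤ w ∧ ∀ x n, (∀ m, |m - n| ≤ w → x m = 0) → T x n = 0

namespace IsLocal

variable {w w' : ℤ} {T U : Module.End ℂ (ℤ → ℂ)}

lemma one : IsLocal 0 1 := ⟨le_rfl, fun x n h => h n (by simp)⟩

lemma mul (hT : IsLocal w T) (hU : IsLocal w' U) : IsLocal (w + w') (T * U) := by
  refine ⟨add_nonneg hT.1 hU.1, fun x n h => hT.2 _ _ fun m hm => hU.2 _ _ fun k hk => h k ?_⟩
  have := abs_add_le (k - m) (m - n)
  rw [sub_add_sub_cancel] at this
  linarith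

lemma sub (hT : IsLocal w T) (hU : IsLocal w' U) : IsLocal (max w w') (T - U) := by
  refine ⟨hT.1.trans (le_max_left _ _), fun x n h => ?_⟩
  rw [LinearMap.sub_apply, Pi.sub_apply, hT.2 x n fun m hm => h m (hm.trans (le_max_left _ _)),
    hU.2 x n fun m hm => h m (hm.trans (le_max_right _ _)), sub_zero]

lemma finSupp (hT : IsLocal w T) {x : ℤ → ℂ} (hx : FinSupp x) : FinSupp (T x) := by
  obtain ⟨R, hR⟩ := hx
  refine ⟨R + w, fun n hn => hT.2 _ _ fun m hm => hR m ?_⟩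
  have := abs_sub_abs_le_abs_sub n m
  rw [abs_sub_comm] at this
  linarith

lemma commutator_cut_apply (hT : IsLocal w T) (N : ℤ) (x : ℤ → ℂ) {n : ℤ}
    (hn : n ∉ Finset.Icc (N - w) (N + w)) : (T (cut N x) - cut N (T x)) n = 0 := by
  have hw := hT.1
  rw [Finset.mem_Icc, not_and_or, not_le, not_le] at hn
  rcases hn with hn | hn
  · have h := hT.2 (cut N x - x) n fun m hm => by
      rw [abs_le] at hm
      simp [cut_apply, show m < N by omega]
    rw [map_sub, Pi.sub_apply] at h
    simpa [cut_apply, show n < N by omega] using h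
  · have h := hT.2 (cut N x) n fun m hm => by
      rw [abs_le] at hm
      simp [cut_apply, show ¬ m < N by omega]
    simp [cut_apply, h, show ¬ n < N by omega]

lemma commutator_cut_finSupp (hT : IsLocal w T) (N : ℤ) (x : ℤ → ℂ) :
    FinSupp (T (cut N x) - cut N (T x)) :=
  finSupp_of_Icc fun _ hn => hT.commutator_cut_apply N x hn

end IsLocal

lemma finSupp_cut_sub_cut (N N' : ℤ) (x : ℤ → ℂ) : FinSupp (cut N x - cut N' x) := by
  refine finSupp_of_Icc (a := min N N') (b := max N N') fun n hn => ?_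
  rw [Finset.mem_Icc, not_and_or, not_le, not_le, lt_min_iff, max_lt_iff] at hn
  rcases hn with ⟨h1, h2⟩ | ⟨h1, h2⟩
  · simp [cut_apply, h1, h2]
  · simp [cut_apply, not_lt.2 h1.le, not_lt.2 h2.le]

/-- Dual families `ψ`, `φ` of sequences depending on a parameter: `φ` is an eigenvector of `Q` and
`ψ` one of its transpose, for the eigenvalue given by the parameter, and differentiation acts as
`-P` on `φ` and as the transpose of `P` on `ψ`. -/
structure DualSystem (Q P : Module.End ℂ (ℤ → ℂ)) (ψ ψ' φ : ℂ → ℤ → ℂ) : Prop where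
  local_Q : ∃ w, IsLocal w Q
  local_P : ∃ w, IsLocal w P
  hasDerivAt_Q : ∀ (u : ℂ → ℤ → ℂ) (u' : ℤ → ℂ) (y : ℂ), (∀ n, HasDerivAt (u · n) (u' n) y) →
    ∀ n, HasDerivAt (fun z => Q (u z) n) (Q u' n) y
  pairing_Q : ∀ y x, FinSupp x → seqPairing (ψ y) (Q x) = y * seqPairing (ψ y) x
  pairing_P : ∀ y x, FinSupp x → seqPairing (ψ y) (P x) = seqPairing (ψ' y) x
  apply_Q : ∀ y, Q (φ y) = y • φ y
  hasDerivAt_ψ : ∀ y n, HasDerivAt (ψ · n) (ψ' y n) y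
  hasDerivAt_φ : ∀ y n, HasDerivAt (φ · n) ((-P (φ y)) n) y

namespace DualSystem

variable {Q P : Module.End ℂ (ℤ → ℂ)} {ψ ψ' φ : ℂ → ℤ → ℂ}

/-- The pairing of `ψ` with the commutator of `Q` and the truncation at `N`, applied to `φ`. -/
noncomputable def flux (Q : Module.End ℂ (ℤ → ℂ)) (ψ φ : ℂ → ℤ → ℂ) (N : ℤ) (y : ℂ) : ℂ :=
  seqPairing (ψ y) (Q (cut N (φ y)) - cut N (Q (φ y)))

lemma flux_eq (h : DualSystem Q P ψ ψ' φ) (N N' : ℤ) (y : ℂ) :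
    flux Q ψ φ N y = flux Q ψ φ N' y := by
  obtain ⟨w, hQ⟩ := h.local_Q
  have hfin := finSupp_cut_sub_cut N N' (φ y)
  rw [← sub_eq_zero, flux, flux,
    ← seqPairing_sub _ (hQ.commutator_cut_finSupp _ _) (hQ.commutator_cut_finSupp _ _)]
  have : Q (cut N (φ y)) - cut N (Q (φ y)) - (Q (cut N' (φ y)) - cut N' (Q (φ y))) =
      Q (cut N (φ y) - cut N' (φ y)) - y • (cut N (φ y) - cut N' (φ y)) := by
    rw [h.apply_Q, map_smul, map_smul, map_sub, smul_sub]
    abel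
  rw [this, seqPairing_sub _ (hQ.finSupp hfin), seqPairing_smul, h.pairing_Q _ _ hfin,
    sub_self]
  obtain ⟨R, hR⟩ := hfin
  exact ⟨R, fun n hn => by simp [hR n hn]⟩

/-- The defect of the canonical commutation relation. -/
def defect (Q P : Module.End ℂ (ℤ → ℂ)) : Module.End ℂ (ℤ → ℂ) := P * Q - Q * P - 1

lemma local_defect (h : DualSystem Q P ψ ψ' φ) : ∃ w, IsLocal w (defect Q P) := by
  obtain ⟨w, hQ⟩ := h.local_Q
  obtain ⟨w', hP⟩ := h.local_P
  exact ⟨_, ((hP.mul hQ).sub (hQ.mul hP)).sub IsLocal.one⟩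

lemma defect_apply (h : DualSystem Q P ψ ψ' φ) (y : ℂ) : defect Q P (φ y) = 0 := by
  have hd : Q (-P (φ y)) = φ y + y • (-P (φ y)) := by
    ext n
    have h1 := h.hasDerivAt_Q φ _ y (h.hasDerivAt_φ y) n
    have h2 := (hasDerivAt_id y).mul (h.hasDerivAt_φ y n)
    refine h1.unique ((h2.congr_of_eventuallyEq ?_).congr_deriv ?_)
    · exact Eventually.of_forall fun z => by simp [h.apply_Q]
    · simp
  rw [map_neg, smul_neg] at hd
  simp only [defect, LinearMap.sub_apply, Module.End.mul_apply, h.apply_Q, map_smul,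
    Module.End.one_apply]
  rw [← sub_eq_zero] at hd
  rw [← hd]
  abel

lemma hasDerivAt_pairing (h : DualSystem Q P ψ ψ' φ) (y : ℂ) {x : ℤ → ℂ} (hx : FinSupp x) :
    HasDerivAt (fun z => seqPairing (ψ z) x) (seqPairing (ψ' y) x) y := by
  obtain ⟨R, hR⟩ := hx
  have hs : ∀ n, n ∉ Finset.Icc (-R) R → x n = 0 := fun n hn =>
    hR n (by rw [Finset.mem_Icc, ← abs_le] at hn; exact not_le.1 hn)
  simp only [seqPairing_eq_sum _ hs]
  exact HasDerivAt.fun_sum fun n _ => (h.hasDerivAt_ψ y n).mul_const _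

lemma pairing_defect (h : DualSystem Q P ψ ψ' φ) (y : ℂ) {x : ℤ → ℂ} (hx : FinSupp x) :
    seqPairing (ψ y) (defect Q P x) = 0 := by
  obtain ⟨w, hQ⟩ := h.local_Q
  obtain ⟨w', hP⟩ := h.local_P
  have hQx := hQ.finSupp hx
  have hPx := hP.finSupp hx
  have h1 : seqPairing (ψ' y) (Q x) = seqPairing (ψ y) x + y * seqPairing (ψ' y) x := by
    have e1 := h.hasDerivAt_pairing y hQx
    have e2 := (hasDerivAt_id y).mul (h.hasDerivAt_pairing y hx)
    refine e1.unique ((e2.congr_of_eventuallyEq ?_).congr_deriv ?_)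
    · exact Eventually.of_forall fun z => by simp [h.pairing_Q z x hx]
    · simp
  change seqPairing (ψ y) (P (Q x) - Q (P x) - x) = 0
  rw [seqPairing_sub _ ((hP.finSupp hQx).sub (hQ.finSupp hPx)) hx,
    seqPairing_sub _ (hP.finSupp hQx) (hQ.finSupp hPx), h.pairing_P _ _ hQx, h.pairing_Q _ _ hPx,
    h.pairing_P _ _ hx, h1]
  ring

lemma hasDerivAt_flux (h : DualSystem Q P ψ ψ' φ) (N : ℤ) (y : ℂ) :
    HasDerivAt (flux Q ψ φ N) (seqPairing (ψ y) (defect Q P (cut N (φ y)))) y := by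
  obtain ⟨w, hQ⟩ := h.local_Q
  obtain ⟨w', hP⟩ := h.local_P
  have hC := hQ.commutator_cut_finSupp N
  set u := φ y
  have hcut : ∀ (v : ℂ → ℤ → ℂ) (v' : ℤ → ℂ), (∀ n, HasDerivAt (v · n) (v' n) y) →
      ∀ n, HasDerivAt (fun z => cut N (v z) n) (cut N v' n) y := by
    intro v v' hv n
    by_cases hn : n < N
    · simpa [cut_apply, hn] using hv n
    · simpa [cut_apply, hn] using hasDerivAt_const y (0 : ℂ)
  have hd : HasDerivAt (flux Q ψ φ N) (seqPairing (ψ' y) (Q (cut N u) - cut N (Q u)) +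
      seqPairing (ψ y) (Q (cut N (-P u)) - cut N (Q (-P u)))) y := by
    have hs := fun x n => hQ.commutator_cut_apply N x (n := n)
    have hfl : flux Q ψ φ N = fun z => ∑ n ∈ Finset.Icc (N - w) (N + w),
        ψ z n * (Q (cut N (φ z)) - cut N (Q (φ z))) n :=
      funext fun z => seqPairing_eq_sum _ (hs _)
    rw [hfl, seqPairing_eq_sum _ (hs u), seqPairing_eq_sum _ (hs (-P u)),
      ← Finset.sum_add_distrib]
    refine HasDerivAt.fun_sum fun n _ => (h.hasDerivAt_ψ y n).mul ?_
    exact (h.hasDerivAt_Q _ _ y (hcut _ _ (h.hasDerivAt_φ y)) n).sub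
      (hcut _ _ (h.hasDerivAt_Q _ _ y (h.hasDerivAt_φ y)) n)
  refine hd.congr_deriv ?_
  have hPcut := hP.commutator_cut_finSupp N u
  have hQPcut := hQ.finSupp hPcut
  have hyPcut : FinSupp (P (cut N (Q u)) - cut N (P (Q u))) :=
    hP.commutator_cut_finSupp N (Q u)
  have hSu := h.defect_apply y
  have key : defect Q P (cut N u) - cut N (defect Q P u) =
      P (Q (cut N u) - cut N (Q u)) - (Q (cut N (P u)) - cut N (Q (P u))) -
        (Q (P (cut N u) - cut N (P u)) - (P (cut N (Q u)) - cut N (P (Q u)))) := by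
    simp only [defect, LinearMap.sub_apply, Module.End.mul_apply, Module.End.one_apply, map_sub]
    abel
  have hz : seqPairing (ψ y) (Q (P (cut N u) - cut N (P u)) -
      (P (cut N (Q u)) - cut N (P (Q u)))) = 0 := by
    rw [seqPairing_sub _ hQPcut hyPcut, h.pairing_Q _ _ hPcut, h.apply_Q, map_smul, map_smul,
      map_smul, map_smul, ← smul_sub, seqPairing_smul, sub_self]
  rw [hSu, map_zero, sub_zero] at key
  rw [key, seqPairing_sub _ ((hP.finSupp (hC u)).sub (hC (P u))) (hQPcut.sub hyPcut), hz, sub_zero,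
    seqPairing_sub _ (hP.finSupp (hC u)) (hC (P u)), h.pairing_P _ _ (hC u),
    sub_eq_add_neg (seqPairing _ _)]
  congr 1
  rw [map_neg, map_neg, map_neg, map_neg, neg_sub_neg, ← neg_sub]
  simpa using seqPairing_smul (ψ y) (-1) (Q (cut N (P u)) - cut N (Q (P u)))

/-- The pairing of `ψ` with the defect of a truncation lies in the span of every left tail of
`ψ`. -/
lemma pairing_defect_cut_mem_span (h : DualSystem Q P ψ ψ' φ) (N : ℤ) (y : ℂ) (k : ℤ) :
    (fun z => seqPairing (ψ z) (defect Q P (cut N (φ y)))) ∈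
      Submodule.span ℂ ((fun n z => ψ z n) '' Set.Iic k) := by
  obtain ⟨w, hS⟩ := h.local_defect
  have hsupp : ∀ M n, n ∉ Finset.Icc (M - w) (M + w) → defect Q P (cut M (φ y)) n = 0 := by
    intro M n hn
    simpa [h.defect_apply] using hS.commutator_cut_apply M (φ y) hn
  have hM : ∀ z, seqPairing (ψ z) (defect Q P (cut N (φ y))) =
      seqPairing (ψ z) (defect Q P (cut (k - w) (φ y))) := by
    intro z
    rw [← sub_eq_zero, ← seqPairing_sub _ (finSupp_of_Icc (hsupp _)) (finSupp_of_Icc (hsupp _)),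
      ← map_sub]
    exact h.pairing_defect z (finSupp_cut_sub_cut _ _ _)
  have heq : (fun z => seqPairing (ψ z) (defect Q P (cut N (φ y)))) =
      ∑ n ∈ Finset.Icc (k - w - w) (k - w + w),
        defect Q P (cut (k - w) (φ y)) n • (fun z => ψ z n) := by
    ext z
    rw [hM, seqPairing_eq_sum _ (hsupp _), Finset.sum_apply]
    exact Finset.sum_congr rfl fun n _ => by simp [mul_comm]
  rw [heq]
  refine Submodule.sum_mem _ fun n hn => Submodule.smul_mem _ _ (Submodule.subset_span ⟨n, ?_, rfl⟩)
  rw [Finset.mem_Icc] at hn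
  simpa using hn.2

/-- If the spans of the left tails of `ψ` contain no common nonzero continuous function, the flux is
constant. -/
lemma exists_flux_eq (h : DualSystem Q P ψ ψ' φ)
    (hψ : ∀ f : ℂ → ℂ, Continuous f →
      (∀ k : ℤ, f ∈ Submodule.span ℂ ((fun n z => ψ z n) '' Set.Iic k)) → f = 0) :
    ∃ c, ∀ N y, flux Q ψ φ N y = c := by
  have hd : ∀ y, HasDerivAt (flux Q ψ φ 0) 0 y := by
    intro y
    have hmem := h.pairing_defect_cut_mem_span 0 y
    obtain ⟨w, hS⟩ := h.local_defect
    have hfin : FinSupp (defect Q P (cut 0 (φ y))) := by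
      simpa [h.defect_apply] using hS.commutator_cut_finSupp 0 (φ y)
    have h0 := hψ _ (continuous_iff_continuousAt.2 fun z =>
      (h.hasDerivAt_pairing z hfin).continuousAt) hmem
    exact (h.hasDerivAt_flux 0 y).congr_deriv (congrFun h0 y)
  refine ⟨flux Q ψ φ 0 0, fun N y => ?_⟩
  rw [h.flux_eq N 0]
  exact is_const_of_deriv_eq_zero (fun z => (hd z).differentiableAt) (fun z => (hd z).deriv) y 0

end DualSystem

/-- The banded operator with coefficient `t j n` from position `n - j` to position `n`, for `j` in a
finite set of offsets. -/
noncomputable def band (s : Finset ℤ) (t : ℤ → ℤ → ℂ) : Module.End ℂ (ℤ → ℂ) where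
  toFun x n := ∑ j ∈ s, t j n * x (n - j)
  map_add' x y := by ext n; simp [mul_add, Finset.sum_add_distrib]
  map_smul' c x := by ext n; simp [Finset.mul_sum, mul_left_comm]

lemma band_apply (s : Finset ℤ) (t : ℤ → ℤ → ℂ) (x : ℤ → ℂ) (n : ℤ) :
    band s t x n = ∑ j ∈ s, t j n * x (n - j) := rfl

lemma isLocal_band (s : Finset ℤ) (t : ℤ → ℤ → ℂ) : IsLocal (∑ j ∈ s, |j|) (band s t) := by
  refine ⟨Finset.sum_nonneg fun j _ => abs_nonneg j, fun x n h => Finset.sum_eq_zero fun j hj => ?_⟩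
  rw [h (n - j), mul_zero]
  rw [sub_sub_cancel_left, abs_neg]
  exact Finset.single_le_sum (f := fun j : ℤ => |j|) (fun j _ => abs_nonneg j) hj

lemma hasDerivAt_band (s : Finset ℤ) (t : ℤ → ℤ → ℂ) (u : ℂ → ℤ → ℂ) (u' : ℤ → ℂ) (y : ℂ)
    (hu : ∀ n, HasDerivAt (u · n) (u' n) y) (n : ℤ) :
    HasDerivAt (fun z => band s t (u z) n) (band s t u' n) y :=
  HasDerivAt.fun_sum fun j _ => (hu (n - j)).const_mul (t j n)

lemma FinSupp.shift {x : ℤ → ℂ} (hx : FinSupp x) (j : ℤ) : FinSupp fun n => x (n - j) := by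
  obtain ⟨R, hR⟩ := hx
  refine ⟨R + |j|, fun n hn => hR _ ?_⟩
  have := abs_sub_abs_le_abs_sub n j
  linarith

lemma seqPairing_band (s : Finset ℤ) (t : ℤ → ℤ → ℂ) (a : ℤ → ℂ) {x : ℤ → ℂ} (hx : FinSupp x) :
    seqPairing a (band s t x) = seqPairing (fun m => ∑ j ∈ s, t j (m + j) * a (m + j)) x := by
  simp only [seqPairing, band_apply, Finset.mul_sum, Finset.sum_mul]
  rw [finsum_sum_comm, finsum_sum_comm]
  · refine Finset.sum_congr rfl fun j _ => ?_
    rw [← finsum_comp_equiv (Equiv.addRight j)]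
    exact finsum_congr fun n => by simp; ring
  · exact fun j _ => hx.hasFiniteSupport fun n => t j (n + j) * a (n + j)
  · intro j _
    have := (hx.shift j).hasFiniteSupport fun n => a n * t j n
    simp only [mul_assoc] at this
    exact this

/-- The commutator of a band operator with a truncation only involves the index pairs separated by
the truncation point. -/
lemma flux_band (d : ℕ) (t : ℤ → ℤ → ℂ) (ψ φ : ℂ → ℤ → ℂ) (N : ℤ) (y : ℂ) :
    DualSystem.flux (band (Finset.Icc (-1) (d : ℤ)) t) ψ φ N y =
      -(t (-1) (N - 1) * ψ y (N - 1) * φ y N) +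
        ∑ j ∈ Finset.Icc (1 : ℤ) d, ∑ k ∈ Finset.Icc (0 : ℤ) (j - 1),
          t j (N + k) * ψ y (N + k) * φ y (N - j + k) := by
  let g : ℤ → ℤ → ℂ := fun j n =>
    t j n * ((if n - j < N then φ y (n - j) else 0) - if n < N then φ y (n - j) else 0)
  have hg : ∀ j, FinSupp (g j) := fun j =>
    finSupp_of_Icc (a := N - |j|) (b := N + |j|) fun n hn => by
      have h1 := neg_abs_le j
      have h2 := le_abs_self j
      rw [Finset.mem_Icc, not_and_or, not_le, not_le] at hn
      rcases hn with hn | hn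
      · simp [g, show n - j < N by omega, show n < N by omega]
      · simp [g, show ¬ n - j < N by omega, show ¬ n < N by omega]
  have hflux : DualSystem.flux (band (Finset.Icc (-1) (d : ℤ)) t) ψ φ N y =
      ∑ j ∈ Finset.Icc (-1) (d : ℤ), seqPairing (ψ y) (g j) := by
    rw [DualSystem.flux]
    simp only [seqPairing]
    rw [← finsum_sum_comm _ _ fun j _ => (hg j).hasFiniteSupport (ψ y)]
    refine finsum_congr fun n => ?_
    rw [← Finset.mul_sum]
    congr 1
    simp only [Pi.sub_apply, cut_apply, band_apply, g, mul_sub, Finset.sum_sub_distrib]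
    by_cases hn : n < N <;> simp [hn]
  have hsplit : Finset.Icc (-1) (d : ℤ) = insert (-1) (insert 0 (Finset.Icc 1 (d : ℤ))) := by
    ext j; simp only [Finset.mem_Icc, Finset.mem_insert]; omega
  rw [hflux, hsplit, Finset.sum_insert (by simp), Finset.sum_insert (by simp)]
  have hneg : seqPairing (ψ y) (g (-1)) = -(t (-1) (N - 1) * ψ y (N - 1) * φ y N) := by
    rw [seqPairing_eq_sum _ (s := {N - 1})]
    · simp [g]; ring
    · intro n hn
      rw [Finset.mem_singleton] at hn
      by_cases h : n < N
      · simp [g, h, show n + 1 < N by omega]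
      · simp [g, h, show ¬ n + 1 < N by omega]
  have hzero : seqPairing (ψ y) (g 0) = 0 := by simp [seqPairing, g]
  rw [hneg, hzero, zero_add]
  congr 1
  refine Finset.sum_congr rfl fun j hj => ?_
  rw [Finset.mem_Icc] at hj
  rw [seqPairing_eq_sum _ (s := Finset.Icc N (N + (j - 1)))]
  · refine (Finset.sum_nbij' (N + ·) (· - N) ?_ ?_ ?_ ?_ ?_).symm
    · intro k hk; rw [Finset.mem_Icc] at hk ⊢; omega
    · intro k hk; rw [Finset.mem_Icc] at hk ⊢; omega
    · intro k _; simp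
    · intro k _; simp
    · intro k hk
      rw [Finset.mem_Icc] at hk
      rw [show N - j + k = N + k - j by ring]
      simp only [g, show N + k - j < N by omega, show ¬ N + k < N by omega, if_true, if_false]
      ring
  · intro n hn
    rw [Finset.mem_Icc, not_and_or, not_le, not_le] at hn
    rcases hn with hn | hn
    · simp [g, hn, show n - j < N by omega]
    · simp [g, show ¬ n < N by omega, show ¬ n - j < N by omega]

lemma sum_Icc_neg (a b : ℤ) (f : ℤ → ℂ) :
    ∑ i ∈ Finset.Icc (-b) (-a), f i = ∑ j ∈ Finset.Icc a b, f (-j) := by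
  refine Finset.sum_nbij' (- ·) (- ·) ?_ ?_ ?_ ?_ ?_
  · intro k hk; rw [Finset.mem_Icc] at hk ⊢; omega
  · intro k hk; rw [Finset.mem_Icc] at hk ⊢; omega
  all_goals simp

lemma sum_Icc_neg_one (d : ℕ) (f : ℤ → ℂ) :
    ∑ j ∈ Finset.Icc (-1) (d : ℤ), f j = f (-1) + ∑ j ∈ Finset.Icc 0 (d : ℤ), f j := by
  have hsplit : Finset.Icc (-1) (d : ℤ) = insert (-1) (Finset.Icc 0 (d : ℤ)) := by
    ext j; simp only [Finset.mem_Icc, Finset.mem_insert]; omega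
  rw [hsplit, Finset.sum_insert (by simp)]

/-- The spans of the left tails of a recursive sequence of functions contain no common nonzero
continuous function. -/
lemma eq_zero_of_forall_mem_span_of_recursion (d : ℕ) (β : ℤ → ℤ → ℂ) (ψ : ℤ → ℂ → ℂ)
    (hrec : ∀ (n : ℤ) (y : ℂ),
      y * ψ n y = ∑ j ∈ Finset.Icc (-1 : ℤ) (d : ℤ), β j (n + j) * ψ (n + j) y)
    {f : ℂ → ℂ} (hf : Continuous f)
    (hmem : ∀ k : ℤ, f ∈ Submodule.span ℂ (ψ '' Set.Iic k)) : f = 0 := by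
  obtain ⟨N, hN, hN0⟩ := exists_doublingNorm
  refine eq_zero_of_eventuallyEq_cofinite hf (hN0 f (hN.eq_zero_of_forall_mem_span ψ
    (fun n => β (-1) (n - 1)) d (fun n => ?_) hmem))
  refine ⟨∑ j ∈ Finset.Icc 0 (d : ℤ), β j (n + j) • ψ (n + j),
    Submodule.sum_mem _ fun j hj => Submodule.smul_mem _ _ (Submodule.subset_span ⟨n + j, ?_, rfl⟩),
    ?_⟩
  · rw [Finset.mem_Icc] at hj
    exact ⟨by omega, by omega⟩
  · ext y
    rw [hrec, sum_Icc_neg_one]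
    simp [sub_eq_add_neg]

/-- The bilinear expression `f_N(y)` built from any solutions of the full system of
recursion and differential relations is independent of `y` and of `N`. -/
theorem pairing_constant (d1 d2 : ℕ) (hd1 : 1 ≤ d1) (hd2 : 1 ≤ d2)
    (α β : ℤ → ℤ → ℂ) (γ : ℤ → ℂ)
    (hαsupp : ∀ j n : ℤ, (j < -1 ∨ (d2 : ℤ) < j) → α j n = 0)
    (hβsupp : ∀ j n : ℤ, (j < -1 ∨ (d1 : ℤ) < j) → β j n = 0)
    (hαγ : ∀ n : ℤ, α (-1) n = γ n)
    (hβγ : ∀ n : ℤ, β (-1) n = γ n)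
    (ψb φ : ℤ → ℂ → ℂ)
    (hψbdiff : ∀ n : ℤ, Differentiable ℂ (ψb n))
    (hφdiff : ∀ n : ℤ, Differentiable ℂ (φ n))
    (hrec_ψb : ∀ (n : ℤ) (y' : ℂ),
      y' * ψb n y' = ∑ j ∈ Finset.Icc (-1 : ℤ) (d1 : ℤ), β j (n + j) * ψb (n + j) y')
    (hder_ψb : ∀ (n : ℤ) (y' : ℂ),
      deriv (ψb n) y' = ∑ l ∈ Finset.Icc (-1 : ℤ) (d2 : ℤ), α l n * ψb (n - l) y')
    (hrec_φ : ∀ (n : ℤ) (y : ℂ),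
      y * φ n y = ∑ j ∈ Finset.Icc (-1 : ℤ) (d1 : ℤ), β j n * φ (n - j) y)
    (hder_φ : ∀ (n : ℤ) (y : ℂ),
      deriv (φ n) y = -(γ (n - 1) * φ (n - 1) y) -
        ∑ j ∈ Finset.Icc (0 : ℤ) (d2 : ℤ), α j (n + j) * φ (n + j) y)
    :
    ∃ c : ℂ, ∀ (N : ℤ) (y : ℂ),
      -(γ (N - 1) * ψb (N - 1) y * φ N y) +
          ∑ j ∈ Finset.Icc (1 : ℤ) (d1 : ℤ), ∑ k ∈ Finset.Icc (0 : ℤ) (j - 1),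
            β j (N + k) * ψb (N + k) y * φ (N - j + k) y = c := by
  let P := band (Finset.Icc (-(d2 : ℤ)) (-(-1))) fun i n => α (-i) (n - i)
  have hP : ∀ x n, P x n = ∑ j ∈ Finset.Icc (-1) (d2 : ℤ), α j (n + j) * x (n + j) := by
    intro x n
    simp only [P, band_apply]
    rw [sum_Icc_neg]
    simp only [neg_neg, sub_neg_eq_add]
  have hsys : DualSystem (band (Finset.Icc (-1) (d1 : ℤ)) β) P (fun y n => ψb n y)
      (fun y n => deriv (ψb n) y) (fun y n => φ n y) :=
    { local_Q := ⟨_, isLocal_band _ _⟩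
      local_P := ⟨_, isLocal_band _ _⟩
      hasDerivAt_Q := hasDerivAt_band _ _
      pairing_Q := fun y x hx => by
        rw [seqPairing_band _ _ _ hx]
        simp only [← hrec_ψb]
        simp only [seqPairing]
        rw [mul_finsum (fun n => ψb n y * x n) y]
        exact finsum_congr fun n => by ring
      pairing_P := fun y x hx => by
        rw [seqPairing_band _ _ _ hx]
        congr 1
        ext m
        rw [sum_Icc_neg, hder_ψb]
        exact Finset.sum_congr rfl fun l _ => by simp [sub_eq_add_neg]
      apply_Q := fun y => by
        ext n
        rw [band_apply, Pi.smul_apply, smul_eq_mul, hrec_φ]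
      hasDerivAt_ψ := fun y n => (hψbdiff n y).hasDerivAt
      hasDerivAt_φ := fun y n => by
        refine (hφdiff n y).hasDerivAt.congr_deriv ?_
        rw [hder_φ, Pi.neg_apply, hP, sum_Icc_neg_one, hαγ, neg_add, sub_eq_add_neg,
          ← sub_eq_add_neg n] }
  obtain ⟨c, hc⟩ := hsys.exists_flux_eq fun f hf hmem =>
    eq_zero_of_forall_mem_span_of_recursion d1 β ψb hrec_ψb hf hmem
  refine ⟨c, fun N y => ?_⟩
  rw [← hc N y, flux_band, hβγ]
end

section
/- Assume γ(n) ≠ 0 and α_{d2}(n) ≠ 0 for all n ∈ ℤ, and assume the entrywise Heisenberg commutation relation for the band matrices P and Q. Then for every N ∈ ℤ and every x ∈ ℂ the differential systems on the dual pair of windows are intertwined by the x-independent matrix 𝔸_N: 𝔸_N·D1_N(x) = D̲1_N(x)·𝔸_N. Moreover 𝔸_N is invertible (its determinant equals ±γ(N−1)·∏_{k=0}^{d2−1} α_{d2}(N+k) ≠ 0), so the two spectral curves coincide: det(y·1_{d2+1} − D1_N(x)) = det(y·1_{d2+1} − D̲1_N(x)) for all x, y ∈ ℂ. -/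
open Matrix BigOperators

noncomputable def D1Mat (d1 d2 : ℕ) (α β : ℤ → ℤ → ℂ) (γ : ℤ → ℂ) (N : ℤ) (x : ℂ) :
    Matrix (Fin (d2 + 1)) (Fin (d2 + 1)) ℂ :=
  Matrix.diagonal (fun i : Fin _ => γ (N - (d2 : ℤ) - 1 + ((i : ℕ) : ℤ))) * (aMat d2 α γ (N - 1) x)⁻¹
    + Matrix.diagonal (fun i : Fin _ => β 0 (N - (d2 : ℤ) + ((i : ℕ) : ℤ)))
    + ∑ j ∈ Finset.Icc 1 d1,
        Matrix.diagonal (fun i : Fin _ => β (j : ℤ) (N + (j : ℤ) - (d2 : ℤ) + ((i : ℕ) : ℤ)))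
          * aProd d2 α γ N x j

noncomputable def AMatx (d2 : ℕ) (α : ℤ → ℤ → ℂ) (γ : ℤ → ℂ) (N : ℤ) :
    Matrix (Fin (d2 + 1)) (Fin (d2 + 1)) ℂ :=
  Matrix.of fun a b =>
    if (a : ℕ) = 0 then (if (b : ℕ) = d2 then -γ (N - 1) else 0)
    else if (a : ℕ) - 1 ≤ (b : ℕ) ∧ (b : ℕ) ≤ d2 - 1 then
      α ((d2 : ℤ) + ((a : ℕ) : ℤ) - 1 - ((b : ℕ) : ℤ)) (N + ((a : ℕ) : ℤ) - 1)
    else 0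


theorem exists_int_orbit {X : Type*} (e : ℤ → X ≃ X) (N : ℤ) (v : X) :
    ∃ W : ℤ → X, W N = v ∧ ∀ n, W (n + 1) = e n (W n) := by
  let up : ℕ → X := fun k => Nat.rec v (fun k y => e (N + k) y) k
  let down : ℕ → X := fun k => Nat.rec v (fun k y => (e (N - 1 - k)).symm y) k
  refine ⟨fun n => if N ≤ n then up (n - N).toNat else down (N - n).toNat, by simp [up], ?_⟩
  intro n
  beta_reduce
  rcases lt_or_ge n N with h | h
  · obtain ⟨k, hk⟩ : ∃ k : ℕ, n = N - 1 - k := ⟨(N - 1 - n).toNat, by omega⟩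
    have h1 : (N - n).toNat = k + 1 := by omega
    have h2 : down (k + 1) = (e (N - 1 - k)).symm (down k) := rfl
    rw [if_neg (not_le.mpr h), h1, h2, ← hk, Equiv.apply_symm_apply]
    rcases Nat.eq_zero_or_pos k with rfl | hk0
    · rw [if_pos (by omega)]
      have h3 : (n + 1 - N).toNat = 0 := by omega
      rw [h3]
      rfl
    · rw [if_neg (by omega)]
      congr 1
      omega
  · obtain ⟨k, hk⟩ : ∃ k : ℕ, n = N + k := ⟨(n - N).toNat, by omega⟩
    have h1 : (n - N).toNat = k := by omega
    have h3 : (n + 1 - N).toNat = k + 1 := by omega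
    rw [if_pos h, if_pos (by omega), h1, h3, hk]

theorem sum_eq_sum_range_of_support (S : Finset ℤ) (f : ℤ → ℂ) (c : ℤ) (d : ℕ)
    (hS : ∀ i : ℕ, i < d → c + i ∈ S)
    (hf : ∀ n : ℤ, (n < c ∨ c + d ≤ n) → f n = 0) :
    ∑ n ∈ S, f n = ∑ i ∈ Finset.range d, f (c + i) := by
  symm
  have hinj : Set.InjOn (fun i : ℕ => c + (i : ℤ)) (Finset.range d) := by
    intro a _ b _ h
    simpa using h
  rw [← Finset.sum_image (f := f) hinj]
  apply Finset.sum_subset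
  · intro n hn
    obtain ⟨i, hi, rfl⟩ := Finset.mem_image.mp hn
    exact hS i (Finset.mem_range.mp hi)
  · intro n _ hn
    apply hf
    by_contra! hcon
    exact hn (Finset.mem_image.mpr
      ⟨(n - c).toNat, Finset.mem_range.mpr (by omega), by omega⟩)

/-- Jacobi identity for the commutators of `p` and `q` with the projection on indices below `N`,
paired with left and right eigenvectors of `q`. -/
theorem concomitant_symmetric (S : Finset ℤ) (N : ℤ) (q p : ℤ → ℤ → ℂ) (φ ψ : ℤ → ℂ)
    (x : ℂ) (w : ℤ)
    (hp : ∀ n m, (w < n - m ∨ w < m - n) → p n m = 0)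
    (hφ : ∀ n, N - w ≤ n → n ≤ N + w → ∑ m ∈ S, q n m * φ m = x * φ n)
    (hψ : ∀ m, N - w ≤ m → m ≤ N + w → ∑ n ∈ S, ψ n * q n m = x * ψ m)
    (hcomm : ∀ n m, ((n < N ∧ N ≤ m) ∨ (m < N ∧ N ≤ n)) →
      ∑ k ∈ S, p n k * q k m = ∑ k ∈ S, q n k * p k m) :
    ∑ n ∈ S, ∑ m ∈ S, (∑ k ∈ S, ψ k * p k n) *
        (q n m * ((if m < N then 1 else 0) - (if n < N then 1 else 0))) * φ m =
      ∑ n ∈ S, ∑ m ∈ S, ψ n *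
        (q n m * ((if m < N then 1 else 0) - (if n < N then 1 else 0))) *
          (∑ k ∈ S, p m k * φ k) := by
  classical
  let Qm : Matrix S S ℂ := Matrix.of fun n m => q n m
  let Pm : Matrix S S ℂ := Matrix.of fun n m => p n m
  let E : Matrix S S ℂ := Matrix.diagonal fun n => if (n : ℤ) < N then 1 else 0
  let f : S → ℂ := fun n => φ n
  let g : S → ℂ := fun n => ψ n
  have hbr : ∀ (Z : Matrix S S ℂ) (n m : S), (Z * E - E * Z) n m =
      Z n m * ((if (m : ℤ) < N then 1 else 0) - (if (n : ℤ) < N then 1 else 0)) := by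
    intro Z n m
    simp only [E, Matrix.sub_apply, Matrix.mul_diagonal, Matrix.diagonal_mul]
    ring
  have hL : ∑ n ∈ S, ∑ m ∈ S, (∑ k ∈ S, ψ k * p k n) *
        (q n m * ((if m < N then 1 else 0) - (if n < N then 1 else 0))) * φ m =
      (g ᵥ* (Pm * (Qm * E - E * Qm))) ⬝ᵥ f := by
    rw [← Matrix.vecMul_vecMul, ← Matrix.dotProduct_mulVec]
    simp only [dotProduct, Matrix.mulVec, Matrix.vecMul, hbr, Finset.mul_sum (s := Finset.univ)]
    simp only [← Finset.sum_coe_sort S, Qm, Pm, f, g, Matrix.of_apply, mul_assoc]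
  have hR : ∑ n ∈ S, ∑ m ∈ S, ψ n *
        (q n m * ((if m < N then 1 else 0) - (if n < N then 1 else 0))) *
          (∑ k ∈ S, p m k * φ k) =
      g ⬝ᵥ (((Qm * E - E * Qm) * Pm) *ᵥ f) := by
    rw [← Matrix.mulVec_mulVec]
    simp only [dotProduct, Matrix.mulVec, hbr, Finset.mul_sum (s := Finset.univ)]
    simp only [← Finset.sum_coe_sort S, Qm, Pm, f, g, Matrix.of_apply, mul_assoc, Finset.mul_sum]
  have hcm : (Pm * Qm - Qm * Pm) * E - E * (Pm * Qm - Qm * Pm) = 0 := by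
    ext n m
    rw [hbr]
    by_cases h : ((n : ℤ) < N ∧ N ≤ m) ∨ ((m : ℤ) < N ∧ N ≤ n)
    · have := hcomm n m h
      rw [← Finset.sum_coe_sort S, ← Finset.sum_coe_sort S] at this
      have h0 : (Pm * Qm - Qm * Pm) n m = 0 := by
        simp only [Matrix.sub_apply, Matrix.mul_apply, Pm, Qm, Matrix.of_apply, this, sub_self]
      rw [h0]; simp
    · have : ((n : ℤ) < N ↔ (m : ℤ) < N) := by omega
      simp [this]
  have hK : ∀ n m : S, ¬ (N - w ≤ (n : ℤ) ∧ (n : ℤ) ≤ N + w ∧ N - w ≤ (m : ℤ) ∧ (m : ℤ) ≤ N + w) →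
      (Pm * E - E * Pm) n m = 0 := by
    intro n m h
    rw [hbr]
    by_cases h1 : w < (n : ℤ) - m ∨ w < (m : ℤ) - n
    · simp [Pm, hp _ _ h1]
    · have : ((n : ℤ) < N ↔ (m : ℤ) < N) := by omega
      simp [this]
  have hgQ : g ᵥ* (Qm * (Pm * E - E * Pm)) = x • (g ᵥ* (Pm * E - E * Pm)) := by
    rw [← Matrix.vecMul_vecMul, ← Matrix.smul_vecMul]
    ext m
    simp only [Matrix.vecMul, dotProduct]
    refine Finset.sum_congr rfl fun n _ => ?_
    by_cases h : N - w ≤ (n : ℤ) ∧ (n : ℤ) ≤ N + w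
    · have := hψ n h.1 h.2
      rw [← Finset.sum_coe_sort S] at this
      simp only [g, Qm, Matrix.of_apply, Pi.smul_apply, smul_eq_mul, this]
    · rw [hK n m (by tauto)]; simp
  have hQf : ((Pm * E - E * Pm) * Qm) *ᵥ f = x • ((Pm * E - E * Pm) *ᵥ f) := by
    rw [← Matrix.mulVec_mulVec, ← Matrix.mulVec_smul]
    ext n
    simp only [Matrix.mulVec, dotProduct]
    refine Finset.sum_congr rfl fun m _ => ?_
    by_cases h : N - w ≤ (m : ℤ) ∧ (m : ℤ) ≤ N + w
    · have := hφ m h.1 h.2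
      rw [← Finset.sum_coe_sort S] at this
      simp only [f, Qm, Matrix.of_apply, Pi.smul_apply, smul_eq_mul, this]
    · rw [hK n m (by tauto)]; simp
  have hJ : Pm * (Qm * E - E * Qm) = (Qm * E - E * Qm) * Pm
      + Qm * (Pm * E - E * Pm) - (Pm * E - E * Pm) * Qm := by
    rw [← sub_eq_zero, ← hcm]
    noncomm_ring
  rw [hL, hR, hJ, Matrix.vecMul_sub, Matrix.vecMul_add, sub_dotProduct, add_dotProduct, hgQ,
    ← Matrix.dotProduct_mulVec g ((Pm * E - E * Pm) * Qm), hQf, ← Matrix.dotProduct_mulVec,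
    smul_dotProduct, dotProduct_smul, ← Matrix.dotProduct_mulVec, add_sub_cancel_right]

/-- Left multiplication of column vectors by an invertible matrix. -/
noncomputable def mulVecEquiv {n : Type*} [Fintype n] [DecidableEq n] (A : Matrix n n ℂ)
    (h : A.det ≠ 0) : (n → ℂ) ≃ (n → ℂ) where
  toFun v := A *ᵥ v
  invFun v := A⁻¹ *ᵥ v
  left_inv v := by simp [Matrix.mulVec_mulVec, Matrix.nonsing_inv_mul _ (isUnit_iff_ne_zero.mpr h)]
  right_inv v := by simp [Matrix.mulVec_mulVec, Matrix.mul_nonsing_inv _ (isUnit_iff_ne_zero.mpr h)]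

theorem aMat_mulVec_of_lt (d2 : ℕ) (α : ℤ → ℤ → ℂ) (γ : ℤ → ℂ) (N : ℤ) (x : ℂ)
    (v : Fin (d2 + 1) → ℂ) (i : Fin d2) :
    (aMat d2 α γ N x *ᵥ v) i.castSucc = v i.succ := by
  have h : ∀ b : Fin (d2 + 1), aMat d2 α γ N x i.castSucc b = if b = i.succ then 1 else 0 := by
    intro b
    simp [aMat, Fin.ext_iff]
  simp [Matrix.mulVec, dotProduct, h]

theorem aMat_mulVec_last (d2 : ℕ) (α : ℤ → ℤ → ℂ) (γ : ℤ → ℂ) (N : ℤ) (x : ℂ)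
    (v : Fin (d2 + 1) → ℂ) :
    (aMat d2 α γ N x *ᵥ v) (Fin.last d2) =
      (x * v (Fin.last d2) - ∑ b : Fin (d2 + 1), α ((d2 : ℤ) - (b : ℕ)) N * v b) / γ N := by
  have h : ∀ b : Fin (d2 + 1), aMat d2 α γ N x (Fin.last d2) b =
      ((if b = Fin.last d2 then x else 0) - α ((d2 : ℤ) - (b : ℕ)) N) / γ N := by
    intro b
    by_cases hb : b = Fin.last d2
    · subst hb; simp [aMat]
    · have : (b : ℕ) ≠ d2 := fun h => hb (Fin.ext h)
      simp [aMat, hb, this]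
  simp only [Matrix.mulVec, dotProduct, h, div_mul_eq_mul_div, ← Finset.sum_div, sub_mul,
    Finset.sum_sub_distrib, ite_mul, zero_mul, Finset.sum_ite_eq', Finset.mem_univ, if_true]

theorem vecMul_abarMat_succ (d2 : ℕ) (α : ℤ → ℤ → ℂ) (γ : ℤ → ℂ) (N : ℤ) (x : ℂ)
    (u : Fin (d2 + 1) → ℂ) (i : Fin d2) :
    (u ᵥ* abarMat d2 α γ N x) i.succ = u i.castSucc := by
  have h : ∀ b : Fin (d2 + 1), abarMat d2 α γ N x b i.succ =
      if b = i.castSucc then 1 else 0 := by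
    intro b
    simp only [abarMat, Matrix.of_apply, Fin.val_succ, Nat.succ_ne_zero, if_false, Fin.ext_iff,
      Fin.val_castSucc, Nat.add_right_cancel_iff, eq_comm (a := (i : ℕ))]
  simp [Matrix.vecMul, dotProduct, h]

theorem vecMul_abarMat_zero (d2 : ℕ) (α : ℤ → ℤ → ℂ) (γ : ℤ → ℂ) (N : ℤ) (x : ℂ)
    (u : Fin (d2 + 1) → ℂ) :
    (u ᵥ* abarMat d2 α γ N x) 0 =
      (x * u 0 - ∑ b : Fin (d2 + 1), u b * α (b : ℕ) (N + (b : ℕ))) / γ (N - 1) := by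
  have h : ∀ b : Fin (d2 + 1), abarMat d2 α γ N x b 0 =
      ((if b = 0 then x else 0) - α (b : ℕ) (N + (b : ℕ))) / γ (N - 1) := by
    intro b
    by_cases hb : b = 0
    · subst hb; simp [abarMat]
    · simp [abarMat, hb]
  simp only [Matrix.vecMul, dotProduct, h, ← mul_div_assoc, ← Finset.sum_div, mul_sub,
    Finset.sum_sub_distrib, mul_ite, mul_zero, Finset.sum_ite_eq', Finset.mem_univ, if_true,
    mul_comm x]

theorem det_aMat_ne_zero (d2 : ℕ) (hd2 : 1 ≤ d2) (α : ℤ → ℤ → ℂ) (γ : ℤ → ℂ)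
    (hγ : ∀ n : ℤ, γ n ≠ 0) (hαd2 : ∀ n : ℤ, α (d2 : ℤ) n ≠ 0) (N : ℤ) (x : ℂ) :
    (aMat d2 α γ N x).det ≠ 0 := by
  intro hdet
  obtain ⟨v, hv, h0⟩ := Matrix.exists_mulVec_eq_zero_iff.mpr hdet
  have hs : ∀ i : Fin d2, v i.succ = 0 := fun i => by
    rw [← aMat_mulVec_of_lt d2 α γ N x v, h0]; rfl
  have hlast : v (Fin.last d2) = 0 := by
    obtain ⟨d, rfl⟩ : ∃ d, d2 = d + 1 := ⟨d2 - 1, by omega⟩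
    exact hs (Fin.last d)
  have h1 := aMat_mulVec_last d2 α γ N x v
  rw [h0, hlast, Fin.sum_univ_succ] at h1
  have h2 : v 0 = 0 := by simpa [hs, hγ, hαd2] using h1.symm
  exact hv (funext fun i => Fin.cases h2 hs i)

theorem det_abarMat_ne_zero (d2 : ℕ) (hd2 : 1 ≤ d2) (α : ℤ → ℤ → ℂ) (γ : ℤ → ℂ)
    (hγ : ∀ n : ℤ, γ n ≠ 0) (hαd2 : ∀ n : ℤ, α (d2 : ℤ) n ≠ 0) (N : ℤ) (x : ℂ) :
    (abarMat d2 α γ N x).det ≠ 0 := by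
  intro hdet
  obtain ⟨u, hu, h0⟩ := Matrix.exists_vecMul_eq_zero_iff.mpr hdet
  have hs : ∀ i : Fin d2, u i.castSucc = 0 := fun i => by
    rw [← vecMul_abarMat_succ d2 α γ N x u, h0]; rfl
  have hzero : u 0 = 0 := by
    obtain ⟨d, rfl⟩ : ∃ d, d2 = d + 1 := ⟨d2 - 1, by omega⟩
    exact hs 0
  have h1 := vecMul_abarMat_zero d2 α γ N x u
  rw [h0, hzero, Fin.sum_univ_castSucc] at h1
  have h2 : u (Fin.last d2) = 0 := by simpa [hs, hγ, hαd2] using h1.symm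
  exact hu (funext fun i => Fin.lastCases h2 hs i)

theorem det_AMatx_ne_zero (d2 : ℕ) (hd2 : 1 ≤ d2) (α : ℤ → ℤ → ℂ) (γ : ℤ → ℂ)
    (hγ : ∀ n : ℤ, γ n ≠ 0) (hαd2 : ∀ n : ℤ, α (d2 : ℤ) n ≠ 0) (N : ℤ) :
    (AMatx d2 α γ N).det ≠ 0 := by
  intro hdet
  obtain ⟨u, hu, h0⟩ := Matrix.exists_vecMul_eq_zero_iff.mpr hdet
  have key : ∀ k : ℕ, ∀ hk : k < d2 + 1, u ⟨k, hk⟩ = 0 := by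
    intro k
    induction k using Nat.strong_induction_on with
    | _ k ih =>
      intro hk
      rcases Nat.eq_zero_or_pos k with rfl | hpos
      · have h1 := congrFun h0 (Fin.last d2)
        simp only [Matrix.vecMul, dotProduct] at h1
        rw [Finset.sum_eq_single (0 : Fin (d2 + 1))] at h1
        · simpa [AMatx, hγ] using h1
        · intro a _ ha
          have : ¬ (d2 ≤ d2 - 1) := by omega
          simp [AMatx, ha, this]
        · simp
      · have h1 := congrFun h0 ⟨k - 1, by omega⟩
        simp only [Matrix.vecMul, dotProduct] at h1
        rw [Finset.sum_eq_single (⟨k, hk⟩ : Fin (d2 + 1))] at h1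
        · have e1 : (d2 : ℤ) + (k : ℤ) - 1 - ((k - 1 : ℕ) : ℤ) = d2 := by omega
          have e2 : k - 1 ≤ d2 - 1 := by omega
          simp only [AMatx, Matrix.of_apply, hpos.ne', if_false, le_refl, e2, and_self, if_true,
            e1, Pi.zero_apply, mul_eq_zero, hαd2, or_false] at h1
          exact h1
        · intro a _ ha
          have ha' : (a : ℕ) ≠ k := fun h => ha (Fin.ext h)
          rcases lt_or_gt_of_ne ha' with h | h
          · rw [ih a h a.2, zero_mul]
          · have e1 : ¬ ((a : ℕ) - 1 ≤ k - 1) := by omega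
            have e2 : (a : ℕ) ≠ 0 := by omega
            simp only [AMatx, Matrix.of_apply, e2, e1, false_and, if_false, mul_zero]
        · simp
  exact hu (funext fun i => key i i.2)

/-- Every vector is the window, ending at index `N`, of a sequence that the matrices `aMat`
propagate. -/
theorem exists_column_solution (d2 : ℕ) (hd2 : 1 ≤ d2) (α : ℤ → ℤ → ℂ) (γ : ℤ → ℂ)
    (hγ : ∀ n : ℤ, γ n ≠ 0) (hαd2 : ∀ n : ℤ, α (d2 : ℤ) n ≠ 0) (N : ℤ) (x : ℂ)
    (v : Fin (d2 + 1) → ℂ) :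
    ∃ φ : ℤ → ℂ, (fun i : Fin (d2 + 1) => φ (N - d2 + (i : ℕ))) = v ∧
      ∀ n, aMat d2 α γ n x *ᵥ (fun i : Fin (d2 + 1) => φ (n - d2 + (i : ℕ))) =
        fun i : Fin (d2 + 1) => φ (n + 1 - d2 + (i : ℕ)) := by
  obtain ⟨W, hWN, hW⟩ := exists_int_orbit
    (fun n => mulVecEquiv _ (det_aMat_ne_zero d2 hd2 α γ hγ hαd2 n x)) N v
  have hstep : ∀ n, W (n + 1) = aMat d2 α γ n x *ᵥ W n := hW
  have hwin : ∀ j : ℕ, ∀ n : ℤ, ∀ i : Fin (d2 + 1), (i : ℕ) + j = d2 →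
      W n i = W (n - d2 + (i : ℕ)) (Fin.last d2) := by
    intro j
    induction j with
    | zero =>
      intro n i hi
      have e : i = Fin.last d2 := Fin.ext (by simpa using hi)
      subst e
      simp
    | succ j ih =>
      intro n i hi
      obtain ⟨i', rfl⟩ : ∃ i' : Fin d2, i = i'.castSucc := ⟨⟨i, by omega⟩, rfl⟩
      simp only [Fin.val_castSucc] at hi
      have h4 : W n i'.castSucc = W (n - 1) i'.succ := by
        rw [← aMat_mulVec_of_lt d2 α γ (n - 1) x (W (n - 1)), ← hstep, sub_add_cancel]
      rw [h4, ih (n - 1) i'.succ (by simp; omega)]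
      congr 1
      simp only [Fin.val_succ, Fin.val_castSucc]
      push_cast
      ring
  have hwin' : ∀ n, (fun i : Fin (d2 + 1) => W (n - d2 + (i : ℕ)) (Fin.last d2)) = W n :=
    fun n => funext fun i => (hwin (d2 - i) n i (by omega)).symm
  refine ⟨fun n => W n (Fin.last d2), by rw [hwin', hWN], fun n => ?_⟩
  rw [hwin', hwin', hstep]

/-- Every vector is the window, starting at index `N`, of a sequence that the matrices `abarMat`
propagate. -/
theorem exists_row_solution (d2 : ℕ) (hd2 : 1 ≤ d2) (α : ℤ → ℤ → ℂ) (γ : ℤ → ℂ)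
    (hγ : ∀ n : ℤ, γ n ≠ 0) (hαd2 : ∀ n : ℤ, α (d2 : ℤ) n ≠ 0) (N : ℤ) (x : ℂ)
    (u : Fin (d2 + 1) → ℂ) :
    ∃ ψ : ℤ → ℂ, (fun i : Fin (d2 + 1) => ψ (N + (i : ℕ))) = u ∧
      ∀ n, (fun i : Fin (d2 + 1) => ψ (n + (i : ℕ))) ᵥ* abarMat d2 α γ n x =
        fun i : Fin (d2 + 1) => ψ (n - 1 + (i : ℕ)) := by
  have hdet : ∀ n, (abarMat d2 α γ n x)ᵀ.det ≠ 0 := fun n => by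
    rw [Matrix.det_transpose]
    exact det_abarMat_ne_zero d2 hd2 α γ hγ hαd2 n x
  obtain ⟨W, hWN, hW⟩ := exists_int_orbit (fun n => mulVecEquiv _ (hdet (-n))) (-N) u
  have hstep : ∀ n, W (-(n - 1)) = W (-n) ᵥ* abarMat d2 α γ n x := fun n => by
    have h := hW (-n)
    rw [show -n + 1 = -(n - 1) by ring] at h
    rw [h, ← Matrix.mulVec_transpose]
    simp [mulVecEquiv]
  have hwin : ∀ j : ℕ, ∀ n : ℤ, ∀ hj : j < d2 + 1, W (-n) ⟨j, hj⟩ = W (-(n + j)) 0 := by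
    intro j
    induction j with
    | zero => intro n _; simp
    | succ j ih =>
      intro n hj
      have h4 : W (-n) ⟨j + 1, hj⟩ = W (-(n + 1)) ⟨j, by omega⟩ := by
        have h := congrFun (hstep (n + 1)) (Fin.succ ⟨j, by omega⟩)
        rw [vecMul_abarMat_succ, add_sub_cancel_right] at h
        exact h
      rw [h4, ih]
      congr 2
      push_cast
      ring
  have hwin' : ∀ n, (fun i : Fin (d2 + 1) => W (-(n + (i : ℕ))) 0) = W (-n) :=
    fun n => funext fun i => (hwin i n i.2).symm
  refine ⟨fun n => W (-n) 0, by rw [hwin', hWN], fun n => ?_⟩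
  rw [hwin', hwin', hstep]

theorem column_recurrence (d2 : ℕ) (α : ℤ → ℤ → ℂ) (γ : ℤ → ℂ)
    (hαsupp : ∀ j n : ℤ, (j < -1 ∨ (d2 : ℤ) < j) → α j n = 0)
    (hαγ : ∀ n : ℤ, α (-1) n = γ n) (hγ : ∀ n : ℤ, γ n ≠ 0) (x : ℂ) (φ : ℤ → ℂ) (n : ℤ)
    (hφ : aMat d2 α γ n x *ᵥ (fun i : Fin (d2 + 1) => φ (n - d2 + (i : ℕ))) =
        fun i : Fin (d2 + 1) => φ (n + 1 - d2 + (i : ℕ)))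
    (S : Finset ℤ) (hS : ∀ m, n - d2 ≤ m → m ≤ n + 1 → m ∈ S) :
    ∑ m ∈ S, α (n - m) n * φ m = x * φ n := by
  rw [sum_eq_sum_range_of_support S _ (n - d2) (d2 + 2)
    (fun i hi => hS _ (by omega) (by omega))
    (fun m hm => by rw [hαsupp _ _ (by push_cast at hm; omega), zero_mul]),
    Finset.sum_range_succ]
  have h := congrFun hφ (Fin.last d2)
  rw [aMat_mulVec_last, div_eq_iff (hγ n),
    Fin.sum_univ_eq_sum_range (fun b => α ((d2 : ℤ) - b) n * φ (n - d2 + b))] at h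
  have e1 : n - (n - d2 + ((d2 + 1 : ℕ) : ℤ)) = -1 := by push_cast; ring
  have e2 : n - d2 + ((d2 + 1 : ℕ) : ℤ) = n + 1 := by push_cast; ring
  have e3 : ∀ i : ℕ, n - (n - d2 + (i : ℤ)) = d2 - i := fun i => by ring
  simp only [Fin.val_last, sub_add_cancel] at h
  rw [e1, e2, hαγ]
  simp only [e3]
  linear_combination -h

theorem row_recurrence (d2 : ℕ) (α : ℤ → ℤ → ℂ) (γ : ℤ → ℂ)
    (hαsupp : ∀ j n : ℤ, (j < -1 ∨ (d2 : ℤ) < j) → α j n = 0)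
    (hαγ : ∀ n : ℤ, α (-1) n = γ n) (hγ : ∀ n : ℤ, γ n ≠ 0) (x : ℂ) (ψ : ℤ → ℂ) (m : ℤ)
    (hψ : (fun i : Fin (d2 + 1) => ψ (m + (i : ℕ))) ᵥ* abarMat d2 α γ m x =
        fun i : Fin (d2 + 1) => ψ (m - 1 + (i : ℕ)))
    (S : Finset ℤ) (hS : ∀ n, m - 1 ≤ n → n ≤ m + d2 → n ∈ S) :
    ∑ n ∈ S, ψ n * α (n - m) n = x * ψ m := by
  rw [sum_eq_sum_range_of_support S _ (m - 1) (d2 + 2)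
    (fun i hi => hS _ (by omega) (by omega))
    (fun n hn => by rw [hαsupp _ _ (by push_cast at hn; omega), mul_zero]),
    Finset.sum_range_succ']
  have h := congrFun hψ 0
  rw [vecMul_abarMat_zero, div_eq_iff (hγ _),
    Fin.sum_univ_eq_sum_range (fun b => ψ (m + b) * α b (m + b))] at h
  have e2 : ∀ i : ℕ, m - 1 + ((i + 1 : ℕ) : ℤ) = m + i := fun i => by push_cast; ring
  have e1 : m - 1 - m = -1 := by ring
  simp only [Fin.val_zero, Nat.cast_zero, add_zero] at h
  simp only [e2, Nat.cast_zero, add_zero, e1, hαγ, add_sub_cancel_left]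
  linear_combination -h

theorem D1Mat_mulVec (d1 d2 : ℕ) (hd2 : 1 ≤ d2) (α β : ℤ → ℤ → ℂ) (γ : ℤ → ℂ)
    (hβsupp : ∀ j n : ℤ, (j < -1 ∨ (d1 : ℤ) < j) → β j n = 0)
    (hβγ : ∀ n : ℤ, β (-1) n = γ n)
    (hγ : ∀ n : ℤ, γ n ≠ 0) (hαd2 : ∀ n : ℤ, α (d2 : ℤ) n ≠ 0) (N : ℤ) (x : ℂ) (φ : ℤ → ℂ)
    (hφ : ∀ n, aMat d2 α γ n x *ᵥ (fun i : Fin (d2 + 1) => φ (n - d2 + (i : ℕ))) =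
        fun i : Fin (d2 + 1) => φ (n + 1 - d2 + (i : ℕ)))
    (S : Finset ℤ) (hS : ∀ m, N - d2 - 1 ≤ m → m ≤ N + d1 → m ∈ S) :
    D1Mat d1 d2 α β γ N x *ᵥ (fun i : Fin (d2 + 1) => φ (N - d2 + (i : ℕ))) =
      fun i : Fin (d2 + 1) =>
        ∑ m ∈ S, β (m - (N - d2 + (i : ℕ))) m * φ m := by
  have hinv : (aMat d2 α γ (N - 1) x)⁻¹ *ᵥ (fun i : Fin (d2 + 1) => φ (N - d2 + (i : ℕ))) =
      fun i : Fin (d2 + 1) => φ (N - 1 - d2 + (i : ℕ)) := by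
    have h := hφ (N - 1)
    rw [sub_add_cancel] at h
    rw [← h, Matrix.mulVec_mulVec, Matrix.nonsing_inv_mul _
      (isUnit_iff_ne_zero.mpr (det_aMat_ne_zero d2 hd2 α γ hγ hαd2 _ x)), Matrix.one_mulVec]
  have hprod : ∀ j : ℕ,
      aProd d2 α γ N x j *ᵥ (fun i : Fin (d2 + 1) => φ (N - d2 + (i : ℕ))) =
        fun i : Fin (d2 + 1) => φ (N + j - d2 + (i : ℕ)) := by
    intro j
    induction j with
    | zero => simp [aProd]
    | succ j ih =>
      rw [aProd, ← Matrix.mulVec_mulVec, ih, hφ]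
      push_cast
      simp only [add_assoc]
  ext i
  have hi := i.2
  rw [sum_eq_sum_range_of_support S _ (N - d2 + (i : ℕ) - 1) (d1 + 2)
    (fun k hk => hS _ (by omega) (by omega))
    (fun m hm => by rw [hβsupp _ _ (by push_cast at hm; omega), zero_mul]),
    Finset.sum_range_succ', Finset.sum_range_succ']
  rw [D1Mat, Matrix.add_mulVec, Matrix.add_mulVec, Matrix.sum_mulVec]
  simp only [← Matrix.mulVec_mulVec, hinv, hprod, Pi.add_apply, Finset.sum_apply,
    Matrix.mulVec_diagonal]
  rw [← Finset.Ico_add_one_right_eq_Icc, Finset.sum_Ico_eq_sum_range, add_tsub_cancel_right]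
  have e0 : N - d2 + (i : ℕ) - 1 + ((0 : ℕ) : ℤ) = N - 1 - d2 + (i : ℕ) := by push_cast; ring
  have e0' : N - 1 - d2 + (i : ℕ) - (N - d2 + (i : ℕ)) = -1 := by ring
  have e0'' : N - d2 - 1 + ((i : ℕ) : ℤ) = N - 1 - d2 + (i : ℕ) := by ring
  have e1 : N - d2 + (i : ℕ) - 1 + ((0 + 1 : ℕ) : ℤ) = N - d2 + (i : ℕ) := by push_cast; ring
  have e2 : ∀ k : ℕ, N - d2 + (i : ℕ) - 1 + ((k + 1 + 1 : ℕ) : ℤ) =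
      N + ((1 + k : ℕ) : ℤ) - d2 + (i : ℕ) := fun k => by push_cast; ring
  have e3 : ∀ k : ℕ, N + ((1 + k : ℕ) : ℤ) - d2 + (i : ℕ) - (N - d2 + (i : ℕ)) =
      ((1 + k : ℕ) : ℤ) := fun k => by ring
  simp only [e0, e0', e0'', e1, e2, e3, sub_self, hβγ]
  ring

theorem vecMul_D1barMat (d1 d2 : ℕ) (hd2 : 1 ≤ d2) (α β : ℤ → ℤ → ℂ) (γ : ℤ → ℂ)
    (hβsupp : ∀ j n : ℤ, (j < -1 ∨ (d1 : ℤ) < j) → β j n = 0)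
    (hβγ : ∀ n : ℤ, β (-1) n = γ n)
    (hγ : ∀ n : ℤ, γ n ≠ 0) (hαd2 : ∀ n : ℤ, α (d2 : ℤ) n ≠ 0) (N : ℤ) (x : ℂ) (ψ : ℤ → ℂ)
    (hψ : ∀ n, (fun i : Fin (d2 + 1) => ψ (n + (i : ℕ))) ᵥ* abarMat d2 α γ n x =
        fun i : Fin (d2 + 1) => ψ (n - 1 + (i : ℕ)))
    (S : Finset ℤ) (hS : ∀ n, N - 1 - d1 ≤ n → n ≤ N + d2 → n ∈ S) :
    (fun i : Fin (d2 + 1) => ψ (N - 1 + (i : ℕ))) ᵥ* D1barMat d1 d2 α β γ N x =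
      fun i : Fin (d2 + 1) =>
        ∑ n ∈ S, ψ n * β (N - 1 + (i : ℕ) - n) (N - 1 + (i : ℕ)) := by
  have hinv : (fun i : Fin (d2 + 1) => ψ (N - 1 + (i : ℕ))) ᵥ* (abarMat d2 α γ N x)⁻¹ =
      fun i : Fin (d2 + 1) => ψ (N + (i : ℕ)) := by
    rw [← hψ N, Matrix.vecMul_vecMul, Matrix.mul_nonsing_inv _
      (isUnit_iff_ne_zero.mpr (det_abarMat_ne_zero d2 hd2 α γ hγ hαd2 _ x)), Matrix.vecMul_one]
  have hprod : ∀ j : ℕ,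
      (fun i : Fin (d2 + 1) => ψ (N - 1 + (i : ℕ))) ᵥ* abarProd d2 α γ N x j =
        fun i : Fin (d2 + 1) => ψ (N - 1 - j + (i : ℕ)) := by
    intro j
    induction j with
    | zero => simp [abarProd]
    | succ j ih =>
      rw [abarProd, ← Matrix.vecMul_vecMul, ih, hψ]
      push_cast
      simp only [sub_sub, add_assoc]
  ext i
  have hi := i.2
  rw [sum_eq_sum_range_of_support S _ (N - 1 + (i : ℕ) - d1) (d1 + 2)
    (fun k hk => hS _ (by omega) (by omega))
    (fun m hm => by rw [hβsupp _ _ (by push_cast at hm; omega), mul_zero]),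
    Finset.sum_range_succ, Finset.sum_range_succ, ← Finset.sum_range_reflect]
  rw [D1barMat, Matrix.vecMul_add, Matrix.vecMul_add, Matrix.vecMul_sum]
  simp only [← Matrix.vecMul_vecMul, hinv, hprod, Pi.add_apply, Finset.sum_apply,
    Matrix.vecMul_diagonal]
  rw [← Finset.Ico_add_one_right_eq_Icc, Finset.sum_Ico_eq_sum_range, add_tsub_cancel_right]
  have e0 : N - 1 + (i : ℕ) - d1 + ((d1 + 1 : ℕ) : ℤ) = N + (i : ℕ) := by push_cast; ring
  have e0' : N - 1 + (i : ℕ) - (N + (i : ℕ)) = -1 := by ring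
  have hsum : ∑ j ∈ Finset.range d1, ψ (N - 1 + (i : ℕ) - d1 + ((d1 - 1 - j : ℕ) : ℤ)) *
        β (N - 1 + (i : ℕ) - (N - 1 + (i : ℕ) - d1 + ((d1 - 1 - j : ℕ) : ℤ))) (N - 1 + (i : ℕ)) =
      ∑ j ∈ Finset.range d1, ψ (N - 1 - ((1 + j : ℕ) : ℤ) + (i : ℕ)) *
        β ((1 + j : ℕ) : ℤ) (N - 1 + (i : ℕ)) := by
    refine Finset.sum_congr rfl fun j hj => ?_
    have := Finset.mem_range.mp hj
    congr 2 <;> omega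
  rw [hsum]
  simp only [e0, e0', sub_add_cancel, sub_self, hβγ]
  ring

/-- The entries of `AMatx` are those of the commutator of `Q` with the projection on indices
below `N`. -/
theorem sum_commutator_eq_AMatx (d2 : ℕ) (α : ℤ → ℤ → ℂ) (γ : ℤ → ℂ)
    (hαsupp : ∀ j n : ℤ, (j < -1 ∨ (d2 : ℤ) < j) → α j n = 0)
    (hαγ : ∀ n : ℤ, α (-1) n = γ n) (hd2 : 1 ≤ d2) (N : ℤ) (u f : ℤ → ℂ)
    (S : Finset ℤ) (hS : ∀ n, N - d2 ≤ n → n ≤ N + d2 → n ∈ S) :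
    ∑ n ∈ S, ∑ m ∈ S, u n *
        (α (n - m) n * ((if m < N then 1 else 0) - (if n < N then 1 else 0))) * f m =
      (fun i : Fin (d2 + 1) => u (N - 1 + (i : ℕ))) ⬝ᵥ
        (AMatx d2 α γ N *ᵥ fun i : Fin (d2 + 1) => f (N - d2 + (i : ℕ))) := by
  have hC : ∀ n m : ℤ, (n < N - 1 ∨ N - 1 + d2 < n ∨ m < N - d2 ∨ N < m) →
      α (n - m) n * ((if m < N then (1 : ℂ) else 0) - (if n < N then 1 else 0)) = 0 := by
    intro n m h
    by_cases h1 : n - m < -1 ∨ (d2 : ℤ) < n - m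
    · rw [hαsupp _ _ h1, zero_mul]
    · have : m < N ↔ n < N := by omega
      simp [this]
  have hA : ∀ a b : Fin (d2 + 1), AMatx d2 α γ N a b =
      α (N - 1 + (a : ℕ) - (N - d2 + (b : ℕ))) (N - 1 + (a : ℕ)) *
        ((if N - d2 + ((b : ℕ) : ℤ) < N then 1 else 0) -
          (if N - 1 + ((a : ℕ) : ℤ) < N then 1 else 0)) := by
    intro a b
    have ha := a.2
    have hb := b.2
    simp only [AMatx, Matrix.of_apply]
    by_cases ha0 : (a : ℕ) = 0
    · rw [if_pos ha0, if_pos (show N - 1 + ((a : ℕ) : ℤ) < N by omega)]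
      by_cases hbd : (b : ℕ) = d2
      · rw [if_pos hbd, if_neg (by omega), hbd, ha0]
        rw [show N - 1 + ((0 : ℕ) : ℤ) - (N - d2 + (d2 : ℤ)) = -1 by push_cast; ring, hαγ]
        simp
      · rw [if_neg hbd, if_pos (by omega)]
        simp
    · rw [if_neg ha0, if_neg (show ¬ N - 1 + ((a : ℕ) : ℤ) < N by omega)]
      by_cases hbd : (b : ℕ) = d2
      · rw [if_neg (by omega), if_neg (by omega)]
        simp
      · rw [if_pos (show N - d2 + ((b : ℕ) : ℤ) < N by omega)]
        split_ifs with h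
        · rw [sub_zero, mul_one]
          congr 1 <;> omega
        · rw [hαsupp _ _ (by omega), zero_mul]
  rw [sum_eq_sum_range_of_support S _ (N - 1) (d2 + 1)
    (fun i hi => hS _ (by omega) (by omega))
    (fun n hn => Finset.sum_eq_zero fun m _ => by
      rw [hC n m (by push_cast at hn; omega)]; simp)]
  rw [← Fin.sum_univ_eq_sum_range (fun i => ∑ m ∈ S, u (N - 1 + (i : ℤ)) *
    (α (N - 1 + (i : ℤ) - m) (N - 1 + (i : ℤ)) *
      ((if m < N then 1 else 0) - (if N - 1 + (i : ℤ) < N then 1 else 0))) * f m)]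
  simp only [dotProduct, Matrix.mulVec, Finset.mul_sum]
  refine Finset.sum_congr rfl fun a _ => ?_
  rw [sum_eq_sum_range_of_support S _ (N - d2) (d2 + 1)
    (fun i hi => hS _ (by omega) (by omega))
    (fun m hm => by rw [hC _ m (by push_cast at hm; omega)]; simp)]
  rw [← Fin.sum_univ_eq_sum_range (fun i => u (N - 1 + (a : ℕ)) *
    (α (N - 1 + (a : ℕ) - (N - d2 + (i : ℤ))) (N - 1 + (a : ℕ)) *
      ((if N - d2 + (i : ℤ) < N then 1 else 0) -
        (if N - 1 + ((a : ℕ) : ℤ) < N then 1 else 0))) * f (N - d2 + (i : ℤ)))]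
  refine Finset.sum_congr rfl fun b _ => ?_
  rw [hA, mul_assoc]

/-- The Heisenberg relation in a form where the sum runs over any set of indices containing the
relevant range, off the diagonal. -/
theorem sum_mul_comm_of_heisenberg (d1 d2 : ℕ) (α β : ℤ → ℤ → ℂ)
    (hαsupp : ∀ j n : ℤ, (j < -1 ∨ (d2 : ℤ) < j) → α j n = 0)
    (hβsupp : ∀ j n : ℤ, (j < -1 ∨ (d1 : ℤ) < j) → β j n = 0)
    (hHeis : ∀ n m : ℤ,
      ∑ k ∈ Finset.Icc (n - (d2 : ℤ) - 1) (n + (d1 : ℤ) + 1),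
        ((-β (k - n) k) * α (k - m) k - α (n - k) n * (-β (m - k) m)) =
        if n = m then 1 else 0)
    (n m : ℤ) (hnm : n ≠ m) (S : Finset ℤ)
    (hS : m - n ≤ d1 + 1 → n - m ≤ d2 + 1 →
      Finset.Icc (n - (d2 : ℤ) - 1) (n + (d1 : ℤ) + 1) ⊆ S) :
    ∑ k ∈ S, β (k - n) k * α (k - m) k = ∑ k ∈ S, α (n - k) n * β (m - k) m := by
  have hleft : ∀ k, ¬ (-1 ≤ k - n ∧ k - n ≤ d1 ∧ -1 ≤ k - m ∧ k - m ≤ d2) →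
      β (k - n) k * α (k - m) k = 0 := by
    intro k hk
    by_cases h : k - n < -1 ∨ (d1 : ℤ) < k - n
    · rw [hβsupp _ _ h, zero_mul]
    · rw [hαsupp _ _ (by omega), mul_zero]
  have hright : ∀ k, ¬ (-1 ≤ n - k ∧ n - k ≤ d2 ∧ -1 ≤ m - k ∧ m - k ≤ d1) →
      α (n - k) n * β (m - k) m = 0 := by
    intro k hk
    by_cases h : n - k < -1 ∨ (d2 : ℤ) < n - k
    · rw [hαsupp _ _ h, zero_mul]
    · rw [hβsupp _ _ (by omega), mul_zero]
  by_cases hband : m - n ≤ d1 + 1 ∧ n - m ≤ d2 + 1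
  · have h := hHeis n m
    rw [if_neg hnm] at h
    have hsub := hS hband.1 hband.2
    rw [← Finset.sum_subset hsub, ← Finset.sum_subset hsub, ← sub_eq_zero,
      ← Finset.sum_sub_distrib, ← neg_eq_zero, ← Finset.sum_neg_distrib, ← h]
    · refine Finset.sum_congr rfl fun k _ => ?_
      ring
    · intro k _ hk
      rw [Finset.mem_Icc] at hk
      exact hright k (by omega)
    · intro k _ hk
      rw [Finset.mem_Icc] at hk
      exact hleft k (by omega)
  · rw [Finset.sum_eq_zero fun k _ => hleft k (by omega),
      Finset.sum_eq_zero fun k _ => hright k (by omega)]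

/-- The matrix `𝔸_N` intertwines the dual differential systems:
`𝔸_N·D1_N(x) = D̲1_N(x)·𝔸_N`; moreover `𝔸_N` is invertible, so the spectral
curves of `D1_N` and `D̲1_N` coincide. -/
theorem intertwining_A (d1 d2 : ℕ) (hd1 : 1 ≤ d1) (hd2 : 1 ≤ d2)
    (α β : ℤ → ℤ → ℂ) (γ : ℤ → ℂ)
    (hαsupp : ∀ j n : ℤ, (j < -1 ∨ (d2 : ℤ) < j) → α j n = 0)
    (hβsupp : ∀ j n : ℤ, (j < -1 ∨ (d1 : ℤ) < j) → β j n = 0)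
    (hαγ : ∀ n : ℤ, α (-1) n = γ n)
    (hβγ : ∀ n : ℤ, β (-1) n = γ n)
    (hγ : ∀ n : ℤ, γ n ≠ 0) (hαd2 : ∀ n : ℤ, α (d2 : ℤ) n ≠ 0)
    (hHeis : ∀ n m : ℤ,
      ∑ k ∈ Finset.Icc (n - (d2 : ℤ) - 1) (n + (d1 : ℤ) + 1),
        ((-β (k - n) k) * α (k - m) k - α (n - k) n * (-β (m - k) m)) =
        if n = m then 1 else 0)
    (N : ℤ) :
    (∀ x : ℂ,
      AMatx d2 α γ N * D1Mat d1 d2 α β γ N x =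
        D1barMat d1 d2 α β γ N x * AMatx d2 α γ N) ∧
    (AMatx d2 α γ N).det ≠ 0 ∧
    ∀ x y : ℂ,
      (y • (1 : Matrix (Fin (d2 + 1)) (Fin (d2 + 1)) ℂ)
          - D1Mat d1 d2 α β γ N x).det =
        (y • (1 : Matrix (Fin (d2 + 1)) (Fin (d2 + 1)) ℂ)
          - D1barMat d1 d2 α β γ N x).det := by
  have hint : ∀ x : ℂ, AMatx d2 α γ N * D1Mat d1 d2 α β γ N x =
      D1barMat d1 d2 α β γ N x * AMatx d2 α γ N := by
    intro x
    refine Matrix.ext_of_mulVec_single fun b => dotProduct_eq _ _ fun u => ?_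
    obtain ⟨φ, hφv, hφ⟩ := exists_column_solution d2 hd2 α γ hγ hαd2 N x (Pi.single b 1)
    obtain ⟨ψ, hψu, hψ⟩ := exists_row_solution d2 hd2 α γ hγ hαd2 (N - 1) x u
    have hmem : ∀ k, k ∈ Finset.Icc (N - 4 * (d1 + d2 + 2)) (N + 4 * (d1 + d2 + 2)) ↔
      N - 4 * (d1 + d2 + 2) ≤ k ∧ k ≤ N + 4 * (d1 + d2 + 2) := fun k => Finset.mem_Icc
    generalize Finset.Icc (N - 4 * (d1 + d2 + 2 : ℤ)) (N + 4 * (d1 + d2 + 2)) = S at hmem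
    rw [dotProduct_comm, dotProduct_comm _ u, ← Matrix.mulVec_mulVec, ← Matrix.mulVec_mulVec,
      Matrix.dotProduct_mulVec u (D1barMat d1 d2 α β γ N x), ← hφv, ← hψu,
      D1Mat_mulVec d1 d2 hd2 α β γ hβsupp hβγ hγ hαd2 N x φ hφ S
        (fun m h1 h2 => (hmem m).mpr (by omega)),
      vecMul_D1barMat d1 d2 hd2 α β γ hβsupp hβγ hγ hαd2 N x ψ hψ S
        (fun m h1 h2 => (hmem m).mpr (by omega)),
      ← sum_commutator_eq_AMatx d2 α γ hαsupp hαγ hd2 N ψ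
        (fun n => ∑ m ∈ S, β (m - n) m * φ m) S (fun m h1 h2 => (hmem m).mpr (by omega)),
      ← sum_commutator_eq_AMatx d2 α γ hαsupp hαγ hd2 N
        (fun n => ∑ k ∈ S, ψ k * β (n - k) n) φ S (fun m h1 h2 => (hmem m).mpr (by omega))]
    refine (concomitant_symmetric S N (fun n m => α (n - m) n) (fun n m => β (m - n) m) φ ψ x
      (d1 + d2 + 2) (fun n m h => hβsupp _ _ (by omega)) (fun n h1 h2 => ?_) (fun m h1 h2 => ?_)
      (fun n m h => ?_)).symm
    · exact column_recurrence d2 α γ hαsupp hαγ hγ x φ n (hφ n) S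
        (fun m h3 h4 => (hmem m).mpr (by omega))
    · exact row_recurrence d2 α γ hαsupp hαγ hγ x ψ m (hψ m) S
        (fun n h3 h4 => (hmem n).mpr (by omega))
    · refine sum_mul_comm_of_heisenberg d1 d2 α β hαsupp hβsupp hHeis n m (by omega) S
        (fun h1 h2 k hk => (hmem k).mpr ?_)
      rw [Finset.mem_Icc] at hk
      omega
  refine ⟨hint, det_AMatx_ne_zero d2 hd2 α γ hγ hαd2 N, fun x y => ?_⟩
  have h : AMatx d2 α γ N * (y • (1 : Matrix (Fin (d2 + 1)) (Fin (d2 + 1)) ℂ)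
      - D1Mat d1 d2 α β γ N x) = (y • (1 : Matrix (Fin (d2 + 1)) (Fin (d2 + 1)) ℂ)
      - D1barMat d1 d2 α β γ N x) * AMatx d2 α γ N := by
    rw [mul_sub, sub_mul, hint]
    simp
  have h' := congrArg Matrix.det h
  rw [Matrix.det_mul, Matrix.det_mul, mul_comm] at h'
  exact mul_right_cancel₀ (det_AMatx_ne_zero d2 hd2 α γ hγ hαd2 N) h'
end

section
/- Assume γ(n) ≠ 0 and β_{d1}(n) ≠ 0 for all n ∈ ℤ, and assume the entrywise Heisenberg commutation relation for the band matrices P and Q. Then for every N ∈ ℤ and every y ∈ ℂ the differential systems on the dual pair of windows are intertwined by the y-independent matrix 𝔹_N: 𝔹_N·D2_N(y) = D̲2_N(y)·𝔹_N. Moreover 𝔹_N is invertible (its determinant equals ±γ(N−1)·∏_{k=0}^{d1−1} β_{d1}(N+k) ≠ 0), so the two spectral curves coincide: det(x·1_{d1+1} − D2_N(y)) = det(x·1_{d1+1} − D̲2_N(y)) for all x, y ∈ ℂ. -/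
open Matrix BigOperators

noncomputable def D2barMat (d1 d2 : ℕ) (α β : ℤ → ℤ → ℂ) (γ : ℤ → ℂ) (N : ℤ) (y : ℂ) :
    Matrix (Fin (d1 + 1)) (Fin (d1 + 1)) ℂ :=
  (abarMat d1 β γ N y)⁻¹ * Matrix.diagonal (fun i : Fin _ => γ (N - 1 + ((i : ℕ) : ℤ)))
    + Matrix.diagonal (fun i : Fin _ => α 0 (N - 1 + ((i : ℕ) : ℤ)))
    + ∑ j ∈ Finset.Icc 1 d2,
        abarProd d1 β γ N y j * Matrix.diagonal (fun i : Fin _ => α (j : ℤ) (N - 1 + ((i : ℕ) : ℤ)))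

namespace BandIntertwining

/-- The operator on two-sided sequences with kernel `A`, truncated to the band of half-width `D`. -/
noncomputable def bandOp (D : ℤ) (A : ℤ → ℤ → ℂ) : Module.End ℂ (ℤ → ℂ) where
  toFun ψ n := ∑ k ∈ Finset.Icc (n - D) (n + D), A n k * ψ k
  map_add' ψ χ := by
    funext n
    simp [mul_add, Finset.sum_add_distrib]
  map_smul' c ψ := by
    funext n
    simp only [Pi.smul_apply, smul_eq_mul, RingHom.id_apply, Finset.mul_sum]
    exact Finset.sum_congr rfl fun k _ => by ring

/-- `A n k` vanishes for `|n - k| > D`. -/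
def IsBanded (D : ℤ) (A : ℤ → ℤ → ℂ) : Prop :=
  ∀ n k, (k < n - D ∨ n + D < k) → A n k = 0

lemma bandOp_apply (D : ℤ) (A : ℤ → ℤ → ℂ) (ψ : ℤ → ℂ) (n : ℤ) :
    bandOp D A ψ n = ∑ k ∈ Finset.Icc (n - D) (n + D), A n k * ψ k := rfl

/-- Restriction of a sequence to the indices below `N`, extended by zero. -/
noncomputable def cutoff (N : ℤ) : Module.End ℂ (ℤ → ℂ) where
  toFun ψ n := if n < N then ψ n else 0
  map_add' ψ χ := by
    funext n
    by_cases h : n < N <;> simp [h]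
  map_smul' c ψ := by
    funext n
    by_cases h : n < N <;> simp [h]

lemma cutoff_apply (N : ℤ) (ψ : ℤ → ℂ) (n : ℤ) :
    cutoff N ψ n = if n < N then ψ n else 0 := rfl

lemma sum_eq_sum_of_support {S T : Finset ℤ} {f : ℤ → ℂ}
    (hS : ∀ k, k ∉ S → f k = 0) (hT : ∀ k, k ∉ T → f k = 0) :
    ∑ k ∈ S, f k = ∑ k ∈ T, f k := by
  rw [← finsum_eq_sum_of_support_subset f (s := S), ← finsum_eq_sum_of_support_subset f (s := T)]
  · intro k hk
    by_contra h
    exact hk (hT k h)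
  · intro k hk
    by_contra h
    exact hk (hS k h)

lemma sum_Icc_eq_sum_fin (c : ℤ) (d : ℕ) (f : ℤ → ℂ) :
    ∑ k ∈ Finset.Icc c (c + d), f k = ∑ i : Fin (d + 1), f (c + ((i : ℕ) : ℤ)) := by
  rw [Fin.sum_univ_eq_sum_range (fun i : ℕ => f (c + (i : ℤ)))]
  symm
  refine Finset.sum_bij (fun i _ => c + (i : ℤ)) ?_ ?_ ?_ ?_
  · intro i hi
    simp only [Finset.mem_range, Finset.mem_Icc] at *
    omega
  · intro i _ j _ h
    simpa using h
  · intro k hk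
    simp only [Finset.mem_Icc] at hk
    exact ⟨(k - c).toNat, by simp only [Finset.mem_range]; omega, by omega⟩
  · intros
    rfl

lemma bandOp_apply_eq_sum {D : ℤ} {A : ℤ → ℤ → ℂ} (hA : IsBanded D A) (ψ : ℤ → ℂ) (n : ℤ)
    (S : Finset ℤ) (hS : ∀ k, k ∉ S → A n k * ψ k = 0) :
    bandOp D A ψ n = ∑ k ∈ S, A n k * ψ k := by
  rw [bandOp_apply]
  refine sum_eq_sum_of_support (fun k hk => ?_) hS
  rw [hA n k (by simp only [Finset.mem_Icc] at hk; omega), zero_mul]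

lemma bandOp_bandOp_apply {D : ℤ} (_ : 0 ≤ D) {A B : ℤ → ℤ → ℂ} (hA : IsBanded D A)
    (hB : IsBanded D B) (ψ : ℤ → ℂ) (n : ℤ) :
    bandOp D A (bandOp D B ψ) n = ∑ k ∈ Finset.Icc (n - 2 * D) (n + 2 * D),
      (∑ l ∈ Finset.Icc (n - 2 * D) (n + 2 * D), A n l * B l k) * ψ k := by
  rw [bandOp_apply_eq_sum hA _ n (Finset.Icc (n - 2 * D) (n + 2 * D))]
  · simp only [Finset.sum_mul]
    rw [Finset.sum_comm]
    refine Finset.sum_congr rfl fun l _ => ?_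
    by_cases hl : l < n - D ∨ n + D < l
    · simp [hA n l hl]
    · rw [bandOp_apply_eq_sum hB _ l (Finset.Icc (n - 2 * D) (n + 2 * D)), Finset.mul_sum]
      · exact Finset.sum_congr rfl fun k _ => by ring
      · intro k hk
        rw [hB l k (by simp only [Finset.mem_Icc] at hk; omega), zero_mul]
  · intro k hk
    rw [hA n k (by simp only [Finset.mem_Icc] at hk; omega), zero_mul]

lemma bandOp_commutator {D : ℤ} (hD : 0 ≤ D) {A B : ℤ → ℤ → ℂ} (hA : IsBanded D A)
    (hB : IsBanded D B)
    (hAB : ∀ n k, ∑ l ∈ Finset.Icc (n - 2 * D) (n + 2 * D), (A n l * B l k - B n l * A l k) =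
      if n = k then 1 else 0) :
    bandOp D A * bandOp D B - bandOp D B * bandOp D A = 1 := by
  ext1 ψ
  funext n
  simp only [LinearMap.sub_apply, Module.End.mul_apply, Pi.sub_apply, Module.End.one_apply]
  rw [bandOp_bandOp_apply hD hA hB, bandOp_bandOp_apply hD hB hA, ← Finset.sum_sub_distrib]
  simp only [← sub_mul, ← Finset.sum_sub_distrib, hAB]
  simp only [ite_mul, one_mul, zero_mul, Finset.sum_ite_eq]
  rw [if_pos]
  simp only [Finset.mem_Icc]
  omega

/-- Moving a banded operator to the other argument of a truncated pairing. -/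
lemma sum_mul_bandOp {D p q : ℤ} (hD : 0 ≤ D) {A : ℤ → ℤ → ℂ} (hA : IsBanded D A)
    (φ u : ℤ → ℂ) (hu : ∀ k, (k < p + D ∨ q - D < k) → u k = 0) :
    ∑ n ∈ Finset.Icc p q, φ n * bandOp D A u n =
      ∑ n ∈ Finset.Icc p q, bandOp D (fun n k => A k n) φ n * u n := by
  have hAt : IsBanded D (fun n k => A k n) := fun n k h => hA k n (by omega)
  have h1 : ∀ n, bandOp D A u n = ∑ k ∈ Finset.Icc p q, A n k * u k := fun n =>
    bandOp_apply_eq_sum hA u n _ fun k hk => by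
      rw [hu k (by simp only [Finset.mem_Icc] at hk; omega), mul_zero]
  simp only [h1, Finset.mul_sum]
  rw [Finset.sum_comm]
  refine Finset.sum_congr rfl fun k _ => ?_
  by_cases hk : k < p + D ∨ q - D < k
  · simp [hu k hk]
  · rw [bandOp_apply_eq_sum hAt φ k (Finset.Icc p q), Finset.sum_mul]
    · exact Finset.sum_congr rfl fun n _ => by ring
    · intro n hn
      rw [hA n k (by simp only [Finset.mem_Icc] at hn; omega), zero_mul]

lemma commutator_cutoff_apply (D N : ℤ) (A : ℤ → ℤ → ℂ) (g : ℤ → ℂ) (n : ℤ) :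
    (bandOp D A * cutoff N - cutoff N * bandOp D A) g n =
      bandOp D (fun n k => A n k * ((if k < N then 1 else 0) - (if n < N then 1 else 0))) g n := by
  simp only [LinearMap.sub_apply, Module.End.mul_apply, Pi.sub_apply, bandOp_apply, cutoff_apply]
  by_cases hn : n < N
  · simp only [hn, if_true, ← Finset.sum_sub_distrib]
    refine Finset.sum_congr rfl fun k _ => ?_
    split_ifs <;> ring
  · simp only [hn, if_false, sub_zero]
    refine Finset.sum_congr rfl fun k _ => ?_
    split_ifs <;> ring

lemma commutator_cutoff_eq_zero {D N : ℤ} (A : ℤ → ℤ → ℂ) (g : ℤ → ℂ) {n : ℤ}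
    (hn : n < N - D ∨ N + D < n) :
    (bandOp D A * cutoff N - cutoff N * bandOp D A) g n = 0 := by
  rw [commutator_cutoff_apply, bandOp_apply]
  refine Finset.sum_eq_zero fun k hk => ?_
  simp only [Finset.mem_Icc] at hk
  rcases hn with hn | hn
  · simp [show k < N by omega, show n < N by omega]
  · simp [show ¬ k < N by omega, show ¬ n < N by omega]

/-- If `[A, B] = 1`, then on joint eigenfunctions of `A` and its transpose the operator `B` is
symmetric for the bilinear concomitant of `A`. -/
lemma concomitant_symm {D : ℤ} (hD : 0 ≤ D) {A B : ℤ → ℤ → ℂ} (hA : IsBanded D A)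
    (hB : IsBanded D B) (hAB : bandOp D A * bandOp D B - bandOp D B * bandOp D A = 1)
    (N : ℤ) {y : ℂ} {φ ψ : ℤ → ℂ} (hψ : bandOp D A ψ = y • ψ)
    (hφ : bandOp D (fun n k => A k n) φ = y • φ) :
    ∑ n ∈ Finset.Icc (N - 2 * D) (N + 2 * D),
        φ n * (bandOp D A * cutoff N - cutoff N * bandOp D A) (bandOp D B ψ) n =
      ∑ n ∈ Finset.Icc (N - 2 * D) (N + 2 * D),
        bandOp D (fun n k => B k n) φ n *
          (bandOp D A * cutoff N - cutoff N * bandOp D A) ψ n := by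
  have hinner (C : ℤ → ℤ → ℂ) (k : ℤ) (hk : k < N - 2 * D + D ∨ N + 2 * D - D < k) :
      (bandOp D C * cutoff N - cutoff N * bandOp D C) ψ k = 0 :=
    commutator_cutoff_eq_zero C ψ (by omega)
  rw [← sum_mul_bandOp hD hB φ _ (hinner A)]
  have hjac : (bandOp D A * cutoff N - cutoff N * bandOp D A) * bandOp D B -
      bandOp D B * (bandOp D A * cutoff N - cutoff N * bandOp D A) =
      (bandOp D B * cutoff N - cutoff N * bandOp D B) * bandOp D A -
        bandOp D A * (bandOp D B * cutoff N - cutoff N * bandOp D B) := by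
    have h : bandOp D A * bandOp D B = 1 + bandOp D B * bandOp D A := by rw [← hAB]; abel
    simp only [mul_sub, sub_mul, ← mul_assoc, h]
    simp only [mul_assoc, h]
    noncomm_ring
  have happ := LinearMap.congr_fun hjac ψ
  rw [LinearMap.sub_apply, LinearMap.sub_apply] at happ
  simp only [Module.End.mul_apply (f := bandOp D A * cutoff N - cutoff N * bandOp D A),
    Module.End.mul_apply (f := bandOp D B * cutoff N - cutoff N * bandOp D B),
    Module.End.mul_apply (g := bandOp D A * cutoff N - cutoff N * bandOp D A),
    Module.End.mul_apply (g := bandOp D B * cutoff N - cutoff N * bandOp D B), hψ,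
    map_smul] at happ
  rw [← sub_eq_zero, ← Finset.sum_sub_distrib]
  have hadj := sum_mul_bandOp hD hA φ _ (hinner B)
  rw [hφ] at hadj
  rw [← sub_eq_zero.mpr hadj.symm, ← Finset.sum_sub_distrib]
  refine Finset.sum_congr rfl fun n _ => ?_
  have hn := congr_fun happ n
  simp only [Pi.sub_apply, Pi.smul_apply, smul_eq_mul] at hn ⊢
  linear_combination φ n * hn

lemma exists_orbit {X : Type*} (e : ℤ → X ≃ X) (N : ℤ) (v : X) :
    ∃ V : ℤ → X, V N = v ∧ ∀ n, V (n + 1) = e n (V n) := by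
  let F : ℕ → X := fun m => Nat.rec v (fun j x => e (N + j) x) m
  let G : ℕ → X := fun m => Nat.rec v (fun j x => (e (N - 1 - j)).symm x) m
  refine ⟨fun n => if N ≤ n then F (n - N).toNat else G (N - n).toNat, by simp [F], fun n => ?_⟩
  by_cases h : N ≤ n
  · obtain ⟨m, rfl⟩ := Int.le.dest h
    simp only [show N ≤ N + (m : ℤ) by omega, show N ≤ N + (m : ℤ) + 1 by omega, if_true]
    rw [show (N + (m : ℤ) + 1 - N).toNat = m + 1 by omega,
      show (N + (m : ℤ) - N).toNat = m by omega]
  · obtain ⟨m, hm⟩ := Int.le.dest (show n + 1 ≤ N by omega)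
    obtain rfl : n = N - 1 - m := by omega
    simp only [h, if_false]
    rw [show (N - (N - 1 - (m : ℤ))).toNat = m + 1 by omega]
    have hG : e (N - 1 - m) (G (m + 1)) = G m := (e (N - 1 - m)).apply_symm_apply (G m)
    rw [hG]
    rcases m with _ | m
    · simp [F, G]
    · rw [if_neg (by push_cast; omega),
        show (N - (N - 1 - ((m + 1 : ℕ) : ℤ) + 1)).toNat = m + 1 by omega]

lemma inv_mulVec_eq_of_mulVec_eq {d : ℕ} (A : Matrix (Fin (d + 1)) (Fin (d + 1)) ℂ) (h : A.det ≠ 0)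
    {u v : Fin (d + 1) → ℂ} (huv : A *ᵥ u = v) : A⁻¹ *ᵥ v = u := by
  rw [← huv, Matrix.mulVec_mulVec, Matrix.nonsing_inv_mul _ (isUnit_iff_ne_zero.mpr h),
    Matrix.one_mulVec]

section Recursion

variable {d : ℕ} {β : ℤ → ℤ → ℂ} {γ : ℤ → ℂ} {y : ℂ}

lemma aMat_mulVec_of_lt (n : ℤ) (v : Fin (d + 1) → ℂ) (i : Fin (d + 1)) (hi : (i : ℕ) < d) :
    (aMat d β γ n y *ᵥ v) i = v ⟨i + 1, by omega⟩ := by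
  rw [Matrix.mulVec, dotProduct, Finset.sum_eq_single ⟨i + 1, by omega⟩]
  · simp [aMat, hi]
  · intro b _ hb
    have : (b : ℕ) ≠ i + 1 := fun h => hb (Fin.ext h)
    simp [aMat, hi, this]
  · simp

lemma aMat_mulVec_last (n : ℤ) (v : Fin (d + 1) → ℂ) :
    (aMat d β γ n y *ᵥ v) (Fin.last d) =
      (y * v (Fin.last d) - ∑ b : Fin (d + 1), β (d - ((b : ℕ) : ℤ)) n * v b) / γ n := by
  rw [Matrix.mulVec, dotProduct, Fin.sum_univ_castSucc, Fin.sum_univ_castSucc]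
  have h : ∀ b : Fin d, (b : ℕ) ≠ d := fun b => b.isLt.ne
  simp only [aMat, Matrix.of_apply, Fin.val_last, lt_irrefl, if_false, Fin.val_castSucc, h,
    if_true, sub_self]
  have hs : ∑ x : Fin d, -β (d - ((x : ℕ) : ℤ)) n / γ n * v x.castSucc =
      -(∑ x : Fin d, β (d - ((x : ℕ) : ℤ)) n * v x.castSucc) / γ n := by
    rw [← Finset.sum_neg_distrib, Finset.sum_div]
    exact Finset.sum_congr rfl fun x _ => by ring
  rw [hs]
  ring

lemma vecMul_abarMat_of_pos (n : ℤ) (v : Fin (d + 1) → ℂ) (b : Fin (d + 1)) (hb : (b : ℕ) ≠ 0) :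
    (v ᵥ* abarMat d β γ n y) b = v ⟨b - 1, by omega⟩ := by
  rw [Matrix.vecMul, dotProduct, Finset.sum_eq_single ⟨b - 1, by omega⟩]
  · simp only [abarMat, Matrix.of_apply, if_neg hb]
    rw [if_pos (by omega), mul_one]
  · intro i _ hi
    have : (b : ℕ) ≠ i + 1 := fun h => hi (Fin.ext (by simp [h]))
    simp only [abarMat, Matrix.of_apply, if_neg hb, if_neg this, mul_zero]
  · simp

lemma vecMul_abarMat_zero (n : ℤ) (v : Fin (d + 1) → ℂ) :
    (v ᵥ* abarMat d β γ n y) 0 =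
      (y * v 0 - ∑ i : Fin (d + 1), β ((i : ℕ) : ℤ) (n + ((i : ℕ) : ℤ)) * v i) / γ (n - 1) := by
  rw [Matrix.vecMul, dotProduct, Fin.sum_univ_succ, Fin.sum_univ_succ]
  simp only [abarMat, Matrix.of_apply, Fin.val_zero, if_true, Fin.val_succ, Nat.succ_ne_zero,
    if_false, Nat.cast_zero, add_zero]
  have hs : ∑ x : Fin d, v x.succ *
        (-β (((x : ℕ) + 1 : ℕ) : ℤ) (n + (((x : ℕ) + 1 : ℕ) : ℤ)) / γ (n - 1)) =
      -(∑ x : Fin d, β (((x : ℕ) + 1 : ℕ) : ℤ) (n + (((x : ℕ) + 1 : ℕ) : ℤ)) * v x.succ) /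
        γ (n - 1) := by
    rw [← Finset.sum_neg_distrib, Finset.sum_div]
    exact Finset.sum_congr rfl fun x _ => by ring
  rw [hs]
  ring

lemma det_aMat_ne_zero (hd : 1 ≤ d) (hγ : ∀ n, γ n ≠ 0) (hβ : ∀ n, β d n ≠ 0) (n : ℤ) :
    (aMat d β γ n y).det ≠ 0 := by
  intro h
  obtain ⟨v, hv, hav⟩ := Matrix.exists_mulVec_eq_zero_iff.mpr h
  have hsucc : ∀ b : Fin d, v b.succ = 0 := fun b => by
    have := congr_fun hav b.castSucc
    rwa [aMat_mulVec_of_lt n v b.castSucc b.isLt] at this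
  have hvlast : v (Fin.last d) = 0 := by
    obtain ⟨e, rfl⟩ := Nat.exists_eq_add_of_le' hd
    exact hsucc (Fin.last e)
  have hlast := congr_fun hav (Fin.last d)
  rw [aMat_mulVec_last, Fin.sum_univ_succ, Pi.zero_apply, div_eq_zero_iff,
    or_iff_left (hγ n)] at hlast
  simp only [hsucc, hvlast, mul_zero, Finset.sum_const_zero, add_zero, Fin.val_zero,
    Nat.cast_zero, sub_zero, zero_sub, neg_eq_zero, mul_eq_zero, hβ n, false_or] at hlast
  exact hv (funext fun b => Fin.cases hlast hsucc b)

lemma det_abarMat_ne_zero (hd : 1 ≤ d) (hγ : ∀ n, γ n ≠ 0) (hβ : ∀ n, β d n ≠ 0) (n : ℤ) :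
    (abarMat d β γ n y).det ≠ 0 := by
  intro h
  obtain ⟨v, hv, hav⟩ := Matrix.exists_vecMul_eq_zero_iff.mpr h
  have hcast : ∀ b : Fin d, v b.castSucc = 0 := fun b => by
    have := congr_fun hav b.succ
    rwa [vecMul_abarMat_of_pos n v b.succ (Nat.succ_ne_zero _)] at this
  have hvzero : v 0 = 0 := by
    obtain ⟨e, rfl⟩ := Nat.exists_eq_add_of_le' hd
    exact hcast 0
  have hzero := congr_fun hav 0
  rw [vecMul_abarMat_zero, Fin.sum_univ_castSucc, Pi.zero_apply, div_eq_zero_iff,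
    or_iff_left (hγ _)] at hzero
  simp only [hcast, hvzero, mul_zero, Finset.sum_const_zero, zero_add, Fin.val_last,
    zero_sub, neg_eq_zero, mul_eq_zero, hβ (n + d), false_or] at hzero
  exact hv (funext fun b => Fin.lastCases hzero hcast b)

variable (d) in
/-- The `d + 1` consecutive values of `ψ` starting at index `c`. -/
def window (ψ : ℤ → ℂ) (c : ℤ) : Fin (d + 1) → ℂ := fun i => ψ (c + ((i : ℕ) : ℤ))

variable (d β γ y) in
/-- The recursion whose transfer matrices are `aMat`. -/
def IsSolution (ψ : ℤ → ℂ) : Prop :=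
  ∀ n, γ n * ψ (n + 1) +
    ∑ b : Fin (d + 1), β (d - ((b : ℕ) : ℤ)) n * ψ (n - d + ((b : ℕ) : ℤ)) = y * ψ n

variable (d β γ y) in
/-- The recursion whose transfer matrices, acting on row vectors, are `abarMat`. -/
def IsDualSolution (φ : ℤ → ℂ) : Prop :=
  ∀ n, γ (n - 1) * φ (n - 1) +
    ∑ i : Fin (d + 1), β ((i : ℕ) : ℤ) (n + ((i : ℕ) : ℤ)) * φ (n + ((i : ℕ) : ℤ)) = y * φ n

lemma IsSolution.aMat_mulVec_window {ψ : ℤ → ℂ} (hψ : IsSolution d β γ y ψ)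
    (hγ : ∀ n, γ n ≠ 0) (n : ℤ) :
    aMat d β γ n y *ᵥ window d ψ (n - d) = window d ψ (n + 1 - d) := by
  funext i
  refine Fin.lastCases ?_ (fun i => ?_) i
  · rw [aMat_mulVec_last, div_eq_iff (hγ n)]
    simp only [window, Fin.val_last]
    rw [sub_add_cancel, sub_add_cancel, ← hψ n]
    ring
  · rw [aMat_mulVec_of_lt n _ _ i.isLt]
    simp only [window, Fin.val_castSucc]
    congr 1
    push_cast
    ring

lemma IsDualSolution.window_vecMul_abarMat {φ : ℤ → ℂ} (hφ : IsDualSolution d β γ y φ)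
    (hγ : ∀ n, γ n ≠ 0) (n : ℤ) :
    window d φ n ᵥ* abarMat d β γ n y = window d φ (n - 1) := by
  funext i
  refine Fin.cases ?_ (fun i => ?_) i
  · rw [vecMul_abarMat_zero, div_eq_iff (hγ _)]
    simp only [window, Fin.val_zero, Nat.cast_zero, add_zero]
    rw [← hφ n]
    ring
  · rw [vecMul_abarMat_of_pos n _ _ (Nat.succ_ne_zero _)]
    simp only [window, Fin.val_succ]
    congr 1
    push_cast
    ring_nf

lemma IsSolution.aProd_mulVec_window {ψ : ℤ → ℂ} (hψ : IsSolution d β γ y ψ)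
    (hγ : ∀ n, γ n ≠ 0) (N : ℤ) (j : ℕ) :
    aProd d β γ N y j *ᵥ window d ψ (N - d) = window d ψ (N + j - d) := by
  induction j with
  | zero => simp [aProd]
  | succ j ih =>
    rw [aProd, ← Matrix.mulVec_mulVec, ih, hψ.aMat_mulVec_window hγ]
    push_cast
    rw [add_assoc]

lemma IsDualSolution.window_vecMul_abarProd {φ : ℤ → ℂ} (hφ : IsDualSolution d β γ y φ)
    (hγ : ∀ n, γ n ≠ 0) (N : ℤ) (j : ℕ) :
    window d φ (N - 1) ᵥ* abarProd d β γ N y j = window d φ (N - 1 - j) := by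
  induction j with
  | zero => simp [abarProd]
  | succ j ih =>
    rw [abarProd, ← Matrix.vecMul_vecMul, ih, hφ.window_vecMul_abarMat hγ]
    push_cast
    rw [sub_sub (N - 1)]

lemma exists_isSolution (hd : 1 ≤ d) (hγ : ∀ n, γ n ≠ 0) (hβ : ∀ n, β d n ≠ 0) (N : ℤ)
    (v : Fin (d + 1) → ℂ) :
    ∃ ψ, IsSolution d β γ y ψ ∧ window d ψ (N - d) = v := by
  have hdet (n : ℤ) : IsUnit (aMat d β γ n y).det :=
    isUnit_iff_ne_zero.mpr (det_aMat_ne_zero hd hγ hβ n)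
  obtain ⟨V, hVN, hV⟩ := exists_orbit (fun n =>
    { toFun := fun u => aMat d β γ n y *ᵥ u
      invFun := fun u => (aMat d β γ n y)⁻¹ *ᵥ u
      left_inv := fun u => by
        simp [Matrix.mulVec_mulVec, Matrix.nonsing_inv_mul _ (hdet n)]
      right_inv := fun u => by
        simp [Matrix.mulVec_mulVec, Matrix.mul_nonsing_inv _ (hdet n)] }) N v
  simp only [Equiv.coe_fn_mk] at hV
  have hshift (t : ℕ) : ∀ (n : ℤ) (i : Fin (d + 1)), (i : ℕ) + t = d →
      V n i = V (n - t) (Fin.last d) := by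
    induction t with
    | zero =>
      intro n i hi
      obtain rfl : i = Fin.last d := Fin.ext (by simpa using hi)
      simp
    | succ t ih =>
      intro n i hi
      have h := hV (n - 1)
      rw [sub_add_cancel] at h
      rw [h, aMat_mulVec_of_lt (n - 1) _ i (by omega), ih (n - 1) _ (by simp only; omega)]
      exact congrArg (fun k => V k (Fin.last d)) (by push_cast; ring)
  have hwin (n : ℤ) : window d (fun m => V m (Fin.last d)) (n - d) = V n := by
    funext i
    rw [hshift (d - i) n i (by omega)]
    simp only [window]
    exact congrArg (fun k => V k (Fin.last d)) (by omega)
  refine ⟨fun m => V m (Fin.last d), fun n => ?_, (hwin N).trans hVN⟩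
  have h := congr_fun (hV n) (Fin.last d)
  rw [aMat_mulVec_last, eq_div_iff (hγ n)] at h
  have hb (b : Fin (d + 1)) : V (n - d + ((b : ℕ) : ℤ)) (Fin.last d) = V n b :=
    congr_fun (hwin n) b
  simp only [hb]
  linear_combination h

end Recursion

lemma exists_isDualSolution {d : ℕ} {β : ℤ → ℤ → ℂ} {γ : ℤ → ℂ} {y : ℂ} (hd : 1 ≤ d)
    (hγ : ∀ n, γ n ≠ 0) (hβ : ∀ n, β d n ≠ 0) (N : ℤ) (w : Fin (d + 1) → ℂ) :
    ∃ φ, IsDualSolution d β γ y φ ∧ window d φ N = w := by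
  obtain ⟨ψ, hψ, hwin⟩ := exists_isSolution (d := d) (β := fun j n => β j (j - n))
    (γ := fun n => γ (-n - 1)) (y := y) hd (fun n => hγ _) (fun n => hβ _) (-N) (fun i => w i.rev)
  refine ⟨fun n => ψ (-n), fun n => ?_, ?_⟩
  · have h := hψ (-n)
    rw [← Equiv.sum_comp Fin.revPerm] at h
    beta_reduce at h ⊢
    rw [← h]
    congr 1
    · rw [show -(-n) - 1 = n - 1 by ring, show -(n - 1) = -n + 1 by ring]
    · refine Finset.sum_congr rfl fun i _ => ?_
      have := i.isLt
      simp only [Fin.revPerm_apply, Fin.val_rev]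
      congr 2
      all_goals omega
  · funext i
    have h := congr_fun hwin i.rev
    rw [Fin.rev_rev] at h
    rw [← h]
    simp only [window, Fin.val_rev]
    congr 1
    omega

/-- The kernel of the recursion operator with coefficients `β`. -/
def recursionKernel (β : ℤ → ℤ → ℂ) (n k : ℤ) : ℂ := β (n - k) n

/-- The kernel of the transposed multiplication operator with coefficients `α`. -/
def transposeKernel (α : ℤ → ℤ → ℂ) (n k : ℤ) : ℂ := α (k - n) k

section Kernels

variable {d : ℕ} {β : ℤ → ℤ → ℂ} {γ : ℤ → ℂ} {D : ℤ}

lemma isBanded_recursionKernel (hD : (d : ℤ) + 1 ≤ D)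
    (hsupp : ∀ j n : ℤ, (j < -1 ∨ (d : ℤ) < j) → β j n = 0) :
    IsBanded D (recursionKernel β) := fun n k h => hsupp _ _ (by omega)

lemma isBanded_transposeKernel (hD : (d : ℤ) + 1 ≤ D)
    (hsupp : ∀ j n : ℤ, (j < -1 ∨ (d : ℤ) < j) → β j n = 0) :
    IsBanded D (transposeKernel β) := fun n k h => hsupp _ _ (by omega)

lemma bandOp_recursionKernel (hD : (d : ℤ) + 1 ≤ D)
    (hsupp : ∀ j n : ℤ, (j < -1 ∨ (d : ℤ) < j) → β j n = 0) (hβγ : ∀ n, β (-1) n = γ n)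
    (ψ : ℤ → ℂ) (n : ℤ) :
    bandOp D (recursionKernel β) ψ n = γ n * ψ (n + 1) +
      ∑ b : Fin (d + 1), β (d - ((b : ℕ) : ℤ)) n * ψ (n - d + ((b : ℕ) : ℤ)) := by
  rw [bandOp_apply_eq_sum (isBanded_recursionKernel hD hsupp) ψ n
    (Finset.Icc (n - d) (n - d + (d + 1 : ℕ))), sum_Icc_eq_sum_fin, Fin.sum_univ_castSucc,
    add_comm]
  · simp only [recursionKernel, Fin.val_last, Fin.val_castSucc]
    congr 1
    · rw [← hβγ, show n - (d : ℤ) + ((d + 1 : ℕ) : ℤ) = n + 1 by push_cast; ring,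
        show n - (n + 1) = -1 by ring]
    · refine Finset.sum_congr rfl fun b _ => ?_
      rw [show n - (n - (d : ℤ) + ((b : ℕ) : ℤ)) = d - ((b : ℕ) : ℤ) by ring]
  · intro k hk
    rw [recursionKernel, hsupp _ _ (by simp only [Finset.mem_Icc] at hk; omega), zero_mul]

lemma bandOp_transposeKernel (hD : (d : ℤ) + 1 ≤ D)
    (hsupp : ∀ j n : ℤ, (j < -1 ∨ (d : ℤ) < j) → β j n = 0) (hβγ : ∀ n, β (-1) n = γ n)
    (φ : ℤ → ℂ) (n : ℤ) :
    bandOp D (transposeKernel β) φ n = γ (n - 1) * φ (n - 1) +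
      ∑ i : Fin (d + 1), β ((i : ℕ) : ℤ) (n + ((i : ℕ) : ℤ)) * φ (n + ((i : ℕ) : ℤ)) := by
  rw [bandOp_apply_eq_sum (isBanded_transposeKernel hD hsupp) φ n
    (Finset.Icc (n - 1) (n - 1 + (d + 1 : ℕ))), sum_Icc_eq_sum_fin, Fin.sum_univ_succ]
  · simp only [transposeKernel, Fin.val_zero, Fin.val_succ, Nat.cast_zero, add_zero]
    congr 1
    · rw [← hβγ, show n - 1 - n = -1 by ring]
    · refine Finset.sum_congr rfl fun b _ => ?_
      rw [show n - 1 + (((b : ℕ) + 1 : ℕ) : ℤ) = n + ((b : ℕ) : ℤ) by push_cast; ring,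
        add_sub_cancel_left]
  · intro k hk
    rw [transposeKernel, hsupp _ _ (by simp only [Finset.mem_Icc] at hk; omega), zero_mul]

/-- `AMatx` is the Gram matrix of the bilinear concomitant on windows. -/
lemma concomitant_eq_window (hD : (d : ℤ) + 1 ≤ D)
    (hsupp : ∀ j n : ℤ, (j < -1 ∨ (d : ℤ) < j) → β j n = 0) (hβγ : ∀ n, β (-1) n = γ n)
    (N : ℤ) (φ g : ℤ → ℂ) :
    ∑ n ∈ Finset.Icc (N - 2 * D) (N + 2 * D), φ n *
        (bandOp D (recursionKernel β) * cutoff N - cutoff N * bandOp D (recursionKernel β)) g n =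
      window d φ (N - 1) ⬝ᵥ (AMatx d β γ N *ᵥ window d g (N - d)) := by
  set C : ℤ → ℤ → ℂ := fun n k =>
    recursionKernel β n k * ((if k < N then 1 else 0) - (if n < N then 1 else 0)) with hC
  have hCzero : ∀ n k, (n < N - 1 ∨ N - 1 + d < n ∨ k < N - d ∨ N < k) → C n k = 0 := by
    intro n k h
    by_cases hk : k < N <;> by_cases hn : n < N
    · simp [hC, hk, hn]
    · simp [hC, recursionKernel, hsupp (n - k) n (by omega)]
    · simp [hC, recursionKernel, hsupp (n - k) n (by omega)]
    · simp [hC, hk, hn]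
  have hCband : IsBanded D C := fun n k h => by
    simp only [hC]
    rw [isBanded_recursionKernel hD hsupp n k h, zero_mul]
  have happ (n : ℤ) : (bandOp D (recursionKernel β) * cutoff N -
      cutoff N * bandOp D (recursionKernel β)) g n =
        ∑ k ∈ Finset.Icc (N - d) (N - d + d), C n k * g k := by
    rw [commutator_cutoff_apply]
    exact bandOp_apply_eq_sum hCband g n _ fun k hk => by
      rw [hCzero n k (by simp only [Finset.mem_Icc] at hk; omega), zero_mul]
  simp only [happ]
  rw [sum_eq_sum_of_support (T := Finset.Icc (N - 1) (N - 1 + d)), sum_Icc_eq_sum_fin]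
  · simp only [dotProduct, Matrix.mulVec, sum_Icc_eq_sum_fin, window]
    refine Finset.sum_congr rfl fun a _ => congrArg _ (Finset.sum_congr rfl fun b _ => ?_)
    congr 1
    have ha := a.isLt
    have hb := b.isLt
    simp only [hC, AMatx, Matrix.of_apply, recursionKernel]
    by_cases ha0 : (a : ℕ) = 0
    · by_cases hbd : (b : ℕ) = d
      · simp [ha0, hbd, ← hβγ]
      · simp [ha0, hbd, show N - (d : ℤ) + ((b : ℕ) : ℤ) < N by omega]
    · rw [if_neg ha0, if_neg (show ¬ N - 1 + ((a : ℕ) : ℤ) < N by omega), sub_zero]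
      by_cases hbd : (b : ℕ) ≤ d - 1
      · rw [if_pos (show N - (d : ℤ) + ((b : ℕ) : ℤ) < N by omega), mul_one]
        split_ifs with hab
        · congr 1 <;> ring
        · exact hsupp _ _ (by omega)
      · rw [if_neg (show ¬ N - (d : ℤ) + ((b : ℕ) : ℤ) < N by omega), mul_zero,
          if_neg (fun h => hbd h.2)]
  · intro n hn
    rw [Finset.sum_eq_zero, mul_zero]
    intro k _
    rw [hCzero n k (by simp only [Finset.mem_Icc] at hn; omega), zero_mul]
  · intro n hn
    rw [Finset.sum_eq_zero, mul_zero]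
    intro k _
    rw [hCzero n k (by simp only [Finset.mem_Icc] at hn; omega), zero_mul]

lemma det_AMatx_ne_zero (hγ : ∀ n, γ n ≠ 0) (hβ : ∀ n, β d n ≠ 0) (N : ℤ) :
    (AMatx d β γ N).det ≠ 0 := by
  have hrot (i : Fin d) : ((finRotate (d + 1) i.castSucc : Fin (d + 1)) : ℕ) = i + 1 :=
    coe_finRotate_of_ne_last (Fin.castSucc_ne_last i)
  have htri : ((AMatx d β γ N).submatrix (finRotate (d + 1)) id).IsUpperTriangular := by
    intro i
    refine Fin.lastCases ?_ (fun i => ?_) i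
    · intro b hib
      have : (b : ℕ) < d := hib
      simp [AMatx, this.ne]
    · intro b hib
      have : (b : ℕ) < i := hib
      simp [AMatx, this]
  have hdet := Matrix.det_of_isUpperTriangular htri
  rw [Matrix.det_permute, Fin.prod_univ_castSucc] at hdet
  intro h
  rw [h, mul_zero] at hdet
  refine mul_ne_zero (Finset.prod_ne_zero_iff.mpr fun i _ => ?_) ?_ hdet.symm
  · have hi : (i : ℕ) ≤ d - 1 := by omega
    simp only [AMatx, Matrix.submatrix_apply, Matrix.of_apply, hrot, id_eq, Fin.val_castSucc]
    rw [if_neg (Nat.succ_ne_zero _), if_pos (by omega),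
      show (d : ℤ) + (((i : ℕ) + 1 : ℕ) : ℤ) - 1 - ((i : ℕ) : ℤ) = d by push_cast; ring]
    exact hβ _
  · simp [AMatx, hγ]

end Kernels

lemma sum_fin_eq_add_sum_Icc (d : ℕ) (f : ℕ → ℂ) :
    ∑ j : Fin (d + 1), f j = f 0 + ∑ j ∈ Finset.Icc 1 d, f j := by
  rw [Fin.sum_univ_eq_sum_range, Finset.range_eq_Ico,
    Finset.sum_eq_sum_Ico_succ_bot (Nat.succ_pos d)]
  rfl

section Systems

variable {d1 d2 : ℕ} {α β : ℤ → ℤ → ℂ} {γ : ℤ → ℂ} {y : ℂ} {D : ℤ}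

lemma D2Mat_mulVec_window (hd1 : 1 ≤ d1) (hD : (d2 : ℤ) + 1 ≤ D)
    (hsupp : ∀ j n : ℤ, (j < -1 ∨ (d2 : ℤ) < j) → α j n = 0) (hαγ : ∀ n, α (-1) n = γ n)
    (hγ : ∀ n, γ n ≠ 0) (hβ : ∀ n, β d1 n ≠ 0) {ψ : ℤ → ℂ} (hψ : IsSolution d1 β γ y ψ) (N : ℤ) :
    D2Mat d1 d2 α β γ N y *ᵥ window d1 ψ (N - d1) =
      window d1 (bandOp D (transposeKernel α) ψ) (N - d1) := by
  have hback : (aMat d1 β γ (N - 1) y)⁻¹ *ᵥ window d1 ψ (N - d1) = window d1 ψ (N - 1 - d1) := by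
    refine inv_mulVec_eq_of_mulVec_eq _ (det_aMat_ne_zero hd1 hγ hβ _) ?_
    rw [hψ.aMat_mulVec_window hγ, sub_add_cancel]
  funext i
  rw [D2Mat, Matrix.add_mulVec, Matrix.add_mulVec, Matrix.sum_mulVec]
  simp only [← Matrix.mulVec_mulVec, hback, hψ.aProd_mulVec_window hγ, Pi.add_apply,
    Finset.sum_apply, Matrix.mulVec_diagonal, window]
  rw [bandOp_transposeKernel hD hsupp hαγ, sum_fin_eq_add_sum_Icc d2 (fun j =>
    α (j : ℤ) (N - d1 + ((i : ℕ) : ℤ) + (j : ℤ)) * ψ (N - d1 + ((i : ℕ) : ℤ) + (j : ℤ))),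
    ← add_assoc]
  congr 1
  · simp only [Nat.cast_zero, add_zero]
    rw [show N - (d1 : ℤ) - 1 + ((i : ℕ) : ℤ) = N - d1 + ((i : ℕ) : ℤ) - 1 by ring,
      show N - 1 - (d1 : ℤ) + ((i : ℕ) : ℤ) = N - d1 + ((i : ℕ) : ℤ) - 1 by ring]
  · refine Finset.sum_congr rfl fun j _ => ?_
    congr 2 <;> ring

lemma window_vecMul_D2barMat (hd1 : 1 ≤ d1) (hD : (d2 : ℤ) + 1 ≤ D)
    (hsupp : ∀ j n : ℤ, (j < -1 ∨ (d2 : ℤ) < j) → α j n = 0) (hαγ : ∀ n, α (-1) n = γ n)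
    (hγ : ∀ n, γ n ≠ 0) (hβ : ∀ n, β d1 n ≠ 0) {φ : ℤ → ℂ} (hφ : IsDualSolution d1 β γ y φ)
    (N : ℤ) :
    window d1 φ (N - 1) ᵥ* D2barMat d1 d2 α β γ N y =
      window d1 (bandOp D (recursionKernel α) φ) (N - 1) := by
  have hforw : window d1 φ (N - 1) ᵥ* (abarMat d1 β γ N y)⁻¹ = window d1 φ N := by
    rw [← hφ.window_vecMul_abarMat hγ, Matrix.vecMul_vecMul, Matrix.mul_nonsing_inv _
      (isUnit_iff_ne_zero.mpr (det_abarMat_ne_zero hd1 hγ hβ _)), Matrix.vecMul_one]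
  funext i
  rw [D2barMat, Matrix.vecMul_add, Matrix.vecMul_add, Matrix.vecMul_sum]
  simp only [← Matrix.vecMul_vecMul, hforw, hφ.window_vecMul_abarProd hγ, Pi.add_apply,
    Finset.sum_apply, Matrix.vecMul_diagonal, window]
  rw [bandOp_recursionKernel hD hsupp hαγ, ← Equiv.sum_comp Fin.revPerm]
  have hrev : ∀ j : Fin (d2 + 1), (((Fin.revPerm j : Fin (d2 + 1)) : ℕ) : ℤ) = d2 - (j : ℕ) := by
    intro j
    rw [Fin.revPerm_apply, Fin.val_rev]
    omega
  simp only [hrev]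
  rw [sum_fin_eq_add_sum_Icc d2 (fun j =>
    α (d2 - (d2 - (j : ℤ))) (N - 1 + ((i : ℕ) : ℤ)) *
      φ (N - 1 + ((i : ℕ) : ℤ) - d2 + (d2 - (j : ℤ)))), ← add_assoc]
  congr 1
  · rw [mul_comm (φ _), mul_comm (φ _)]
    congr 3 <;> push_cast <;> ring_nf
  · refine Finset.sum_congr rfl fun j _ => ?_
    rw [mul_comm]
    congr 2 <;> ring

end Systems

lemma commutator_of_heisenberg {d1 d2 : ℕ} {α β : ℤ → ℤ → ℂ}
    (hαsupp : ∀ j n : ℤ, (j < -1 ∨ (d2 : ℤ) < j) → α j n = 0)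
    (hβsupp : ∀ j n : ℤ, (j < -1 ∨ (d1 : ℤ) < j) → β j n = 0)
    (hHeis : ∀ n m : ℤ,
      ∑ k ∈ Finset.Icc (n - (d2 : ℤ) - 1) (n + (d1 : ℤ) + 1),
        ((-β (k - n) k) * α (k - m) k - α (n - k) n * (-β (m - k) m)) =
        if n = m then 1 else 0) {D : ℤ} (hD : (d1 : ℤ) + d2 + 1 ≤ D) :
    bandOp D (recursionKernel β) * bandOp D (transposeKernel α) -
      bandOp D (transposeKernel α) * bandOp D (recursionKernel β) = 1 := by
  refine bandOp_commutator (by omega) (isBanded_recursionKernel (d := d1) (by omega) hβsupp)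
    (isBanded_transposeKernel (d := d2) (by omega) hαsupp) fun n k => ?_
  have h := hHeis k n
  simp only [eq_comm (a := k)] at h
  rw [← h, sum_eq_sum_of_support (T := Finset.Icc (k - (d2 : ℤ) - 1) (k + (d1 : ℤ) + 1))]
  · refine Finset.sum_congr rfl fun l _ => ?_
    simp only [recursionKernel, transposeKernel]
    ring
  all_goals
    intro l hl
    simp only [Finset.mem_Icc] at hl
    simp only [recursionKernel, transposeKernel]
  · rw [hβsupp (n - l) n (by omega), hαsupp (l - n) l (by omega)]
    ring
  · rw [hαsupp (k - l) k (by omega), hβsupp (l - k) l (by omega)]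
    ring

/-- The intertwining relation, obtained by pairing with arbitrary windows of solutions. -/
lemma AMatx_mul_D2Mat {d1 d2 : ℕ} {α β : ℤ → ℤ → ℂ} {γ : ℤ → ℂ} (hd1 : 1 ≤ d1)
    (hαsupp : ∀ j n : ℤ, (j < -1 ∨ (d2 : ℤ) < j) → α j n = 0)
    (hβsupp : ∀ j n : ℤ, (j < -1 ∨ (d1 : ℤ) < j) → β j n = 0)
    (hαγ : ∀ n : ℤ, α (-1) n = γ n) (hβγ : ∀ n : ℤ, β (-1) n = γ n)
    (hγ : ∀ n : ℤ, γ n ≠ 0) (hβd1 : ∀ n : ℤ, β (d1 : ℤ) n ≠ 0)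
    (hHeis : ∀ n m : ℤ,
      ∑ k ∈ Finset.Icc (n - (d2 : ℤ) - 1) (n + (d1 : ℤ) + 1),
        ((-β (k - n) k) * α (k - m) k - α (n - k) n * (-β (m - k) m)) =
        if n = m then 1 else 0) (N : ℤ) (y : ℂ) :
    AMatx d1 β γ N * D2Mat d1 d2 α β γ N y = D2barMat d1 d2 α β γ N y * AMatx d1 β γ N := by
  obtain ⟨D, hD⟩ : ∃ D : ℤ, D = (d1 : ℤ) + d2 + 1 := ⟨_, rfl⟩
  have hD1 : (d1 : ℤ) + 1 ≤ D := by omega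
  have hD2 : (d2 : ℤ) + 1 ≤ D := by omega
  have hpair (w v : Fin (d1 + 1) → ℂ) :
      w ⬝ᵥ ((AMatx d1 β γ N * D2Mat d1 d2 α β γ N y) *ᵥ v) =
        w ⬝ᵥ ((D2barMat d1 d2 α β γ N y * AMatx d1 β γ N) *ᵥ v) := by
    obtain ⟨ψ, hψ, rfl⟩ := exists_isSolution (y := y) hd1 hγ hβd1 N v
    obtain ⟨φ, hφ, rfl⟩ := exists_isDualSolution (y := y) hd1 hγ hβd1 (N - 1) w
    rw [← Matrix.mulVec_mulVec, D2Mat_mulVec_window hd1 hD2 hαsupp hαγ hγ hβd1 hψ,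
      ← Matrix.mulVec_mulVec, Matrix.dotProduct_mulVec _ (D2barMat d1 d2 α β γ N y),
      window_vecMul_D2barMat hd1 hD2 hαsupp hαγ hγ hβd1 hφ,
      ← concomitant_eq_window hD1 hβsupp hβγ, ← concomitant_eq_window hD1 hβsupp hβγ]
    refine concomitant_symm (by omega) (isBanded_recursionKernel hD1 hβsupp)
      (isBanded_transposeKernel hD2 hαsupp)
      (commutator_of_heisenberg hαsupp hβsupp hHeis hD.ge) N (y := y) ?_ ?_
    · funext n
      rw [bandOp_recursionKernel hD1 hβsupp hβγ]
      exact hψ n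
    · funext n
      exact (bandOp_transposeKernel hD1 hβsupp hβγ φ n).trans (hφ n)
  ext i j
  simpa using hpair (Pi.single i 1) (Pi.single j 1)

end BandIntertwining

/-- The matrix `𝔹_N` intertwines the dual differential systems:
`𝔹_N·D2_N(y) = D̲2_N(y)·𝔹_N`; moreover `𝔹_N` is invertible, so the spectral
curves of `D2_N` and `D̲2_N` coincide. -/
theorem intertwining_B (d1 d2 : ℕ) (hd1 : 1 ≤ d1) (hd2 : 1 ≤ d2)
    (α β : ℤ → ℤ → ℂ) (γ : ℤ → ℂ)
    (hαsupp : ∀ j n : ℤ, (j < -1 ∨ (d2 : ℤ) < j) → α j n = 0)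
    (hβsupp : ∀ j n : ℤ, (j < -1 ∨ (d1 : ℤ) < j) → β j n = 0)
    (hαγ : ∀ n : ℤ, α (-1) n = γ n)
    (hβγ : ∀ n : ℤ, β (-1) n = γ n)
    (hγ : ∀ n : ℤ, γ n ≠ 0) (hβd1 : ∀ n : ℤ, β (d1 : ℤ) n ≠ 0)
    (hHeis : ∀ n m : ℤ,
      ∑ k ∈ Finset.Icc (n - (d2 : ℤ) - 1) (n + (d1 : ℤ) + 1),
        ((-β (k - n) k) * α (k - m) k - α (n - k) n * (-β (m - k) m)) =
        if n = m then 1 else 0)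
    (N : ℤ) :
    (∀ y : ℂ,
      AMatx d1 β γ N * D2Mat d1 d2 α β γ N y =
        D2barMat d1 d2 α β γ N y * AMatx d1 β γ N) ∧
    (AMatx d1 β γ N).det ≠ 0 ∧
    ∀ x y : ℂ,
      (x • (1 : Matrix (Fin (d1 + 1)) (Fin (d1 + 1)) ℂ)
          - D2Mat d1 d2 α β γ N y).det =
        (x • (1 : Matrix (Fin (d1 + 1)) (Fin (d1 + 1)) ℂ)
          - D2barMat d1 d2 α β γ N y).det := by
  have hint := BandIntertwining.AMatx_mul_D2Mat hd1 hαsupp hβsupp hαγ hβγ hγ hβd1 hHeis N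
  have hdet := BandIntertwining.det_AMatx_ne_zero hγ hβd1 N
  refine ⟨hint, hdet, fun x y => mul_left_cancel₀ hdet ?_⟩
  rw [← Matrix.det_mul, mul_comm, ← Matrix.det_mul, Matrix.mul_sub, Matrix.sub_mul, hint y]
  simp
end
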